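/- arXiv:2502.16004 — 3 statements merged into one kernel-verified Lean document; each statement's English description precedes it below -/
import Mathlib

section
/- Let R be a commutative Noetherian local ring with residue field k. If Ext^i_R(k,R) = 0 for all i > n for some integer n, then R has finite injective dimension as a module over itself (i.e., R is Gorenstein), and inj.dim_R(R) = sup{ i : Ext^i_R(k,R) ≠ 0 }. -/
/-!
STATEMENT 3: Let `R` be a commutative Noetherian local ring with residue field `k`.
If `Ext^i_R(k,R) = 0` for all `i > n` for some `n`, then `R` has finite injective dimension
over itself (`R` is Gorenstein), and `inj.dim_R(R) = sup { i : Ext^i_R(k,R) ≠ 0 }`.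
-/

open CategoryTheory

/-- `Ext^n_R(M, N)` as an `R`-module, via the derived functor `Ext` of Mathlib. -/
noncomputable def extRMod (R : Type) [CommRing R] (M N : ModuleCat R) (n : ℕ) : ModuleCat R :=
  ((Ext R (ModuleCat R) n).obj (Opposite.op M)).obj N

/-- Vanishing of `Ext^n_R(M, N)`. -/
def extVanish (R : Type) [CommRing R] (M N : ModuleCat R) (n : ℕ) : Prop :=
  Subsingleton (extRMod R M N n)

/-- `M` has injective dimension at most `n`: `Ext^i(N, M) = 0` for every module `N` and
every `i > n`. -/
def injDimLE (R : Type) [CommRing R] (M : ModuleCat R) (n : ℕ) : Prop :=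
  ∀ (N : ModuleCat R) (i : ℕ), n < i → extVanish R N M i

/-- `M` has projective dimension at most `n`: `Ext^i(M, N) = 0` for every module `N` and
every `i > n`. -/
def projDimLE (R : Type) [CommRing R] (M : ModuleCat R) (n : ℕ) : Prop :=
  ∀ (N : ModuleCat R) (i : ℕ), n < i → extVanish R M N i

/-- A commutative Noetherian local ring is Gorenstein if it has finite injective dimension
as a module over itself. -/
def IsGorensteinRing (R : Type) [CommRing R] : Prop :=
  ∃ n : ℕ, injDimLE R (ModuleCat.of R R) n

/-- The injective dimension of `M`, as an extended natural number. -/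
noncomputable def injDim (R : Type) [CommRing R] (M : ModuleCat R) : ℕ∞ :=
  sInf {c : ℕ∞ | ∃ n : ℕ, c = n ∧ injDimLE R M n}

open Abelian

universe u v w

/-- In positive degrees, the `Ext` groups defined as left derived functors vanish if and only if
those defined using morphisms in the derived category vanish. -/
lemma subsingleton_derivedExt_succ_iff {R : Type u} [Ring R] {C : Type v} [Category.{w} C]
    [Abelian C] [Linear R C] [EnoughProjectives C] [HasExt.{w} C] (X Y : C) (n : ℕ) :
    Subsingleton (((_root_.Ext R C (n + 1)).obj (Opposite.op X)).obj Y) ↔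
      Subsingleton (Abelian.Ext.{w} X Y (n + 1)) := by
  let P := projectiveResolution X
  rw [← ModuleCat.isZero_iff_subsingleton, (P.isoExt (R := R) (n + 1) Y).isZero_iff,
    ← HomologicalComplex.exactAt_iff_isZero_homology,
    HomologicalComplex.exactAt_iff' _ n (n + 1) (n + 2) (by simp) (by simp),
    ShortComplex.moduleCat_exact_iff]
  have key : (∀ (x : P.complex.X (n + 1) ⟶ Y), P.complex.d (n + 2) (n + 1) ≫ x = 0 →
      ∃ y : P.complex.X n ⟶ Y, P.complex.d (n + 1) n ≫ y = x) ↔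
      Subsingleton (Abelian.Ext.{w} X Y (n + 1)) := by
    refine ⟨fun H ↦ subsingleton_of_forall_eq 0 fun α ↦ ?_, fun _ x hx ↦ ?_⟩
    · obtain ⟨f, hf, rfl⟩ := P.extMk_surjective α (n + 2) rfl
      exact (P.extMk_eq_zero_iff f _ rfl hf n rfl).2 (H f hf)
    · exact (P.extMk_eq_zero_iff x _ rfl hx n rfl).1 (Subsingleton.elim _ _)
  exact key

lemma extVanish_iff_subsingleton_ext {R : Type} [CommRing R] (M N : ModuleCat R) {n : ℕ}
    (hn : 0 < n) : extVanish R M N n ↔ Subsingleton (Abelian.Ext.{0} M N n) := by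
  obtain ⟨n, rfl⟩ := Nat.exists_eq_succ_of_ne_zero hn.ne'
  exact subsingleton_derivedExt_succ_iff M N n

namespace ModuleCat

variable {R : Type u} [CommRing R]

lemma subsingleton_ext_of_linearEquiv {N N' : Type u} [AddCommGroup N] [Module R N]
    [AddCommGroup N'] [Module R N'] (e : N ≃ₗ[R] N') (M : ModuleCat.{u} R) (i : ℕ)
    [Subsingleton (Ext.{u} (of R N) M i)] : Subsingleton (Ext.{u} (of R N') M i) := by
  refine subsingleton_of_forall_eq 0 fun α ↦ ?_
  have h : (Ext.mk₀ (ofHom e.toLinearMap)).comp α (zero_add i) = 0 := Subsingleton.elim _ _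
  have h' : α = (Ext.mk₀ (ofHom e.symm.toLinearMap)).comp
      ((Ext.mk₀ (ofHom e.toLinearMap)).comp α (zero_add i)) (zero_add i) := by
    rw [Ext.mk₀_comp_mk₀_assoc, ← ofHom_comp]
    simp
  rw [h', h, Ext.comp_zero]

lemma subsingleton_ext_X₂ {S : ShortComplex (ModuleCat.{u} R)} (hS : S.ShortExact)
    (M : ModuleCat.{u} R) (i : ℕ) [Subsingleton (Ext.{u} S.X₁ M i)]
    [Subsingleton (Ext.{u} S.X₃ M i)] : Subsingleton (Ext.{u} S.X₂ M i) := by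
  refine subsingleton_of_forall_eq 0 fun α ↦ ?_
  obtain ⟨β, rfl⟩ := Ext.contravariant_sequence_exact₂ hS M α (Subsingleton.elim _ _)
  rw [Subsingleton.elim β 0, Ext.comp_zero]

/-- Baer's criterion, phrased in terms of `Ext`. -/
lemma injective_of_subsingleton_ext_quotient (M : ModuleCat.{u} R)
    (h : ∀ I : Ideal R, Subsingleton (Ext.{u} (of R (R ⧸ I)) M 1)) : Injective M := by
  suffices Module.Baer R M from
    (Module.injective_iff_injective_object R M).1 this.injective
  intro I g
  let S : ShortComplex (ModuleCat.{u} R) :=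
    shortComplexOfCompEqZero I.subtype I.mkQ (LinearMap.exact_subtype_mkQ I).linearMap_comp_eq_zero
  have hS : S.ShortExact := shortComplex_shortExact S (LinearMap.exact_subtype_mkQ I)
    I.injective_subtype I.mkQ_surjective
  have : Subsingleton (Ext.{u} S.X₃ M 1) := h I
  obtain ⟨β, hβ⟩ := Ext.contravariant_sequence_exact₁ hS M (Ext.mk₀ (ofHom g)) (add_zero 1)
    (Subsingleton.elim _ _)
  obtain ⟨φ, rfl⟩ := Ext.homEquiv₀.symm.surjective β
  rw [Ext.homEquiv₀_symm_apply, Ext.mk₀_comp_mk₀] at hβ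
  have hφ := (Ext.mk₀_bijective _ _).1 hβ
  exact ⟨φ.hom, fun x hx ↦ ConcreteCategory.congr_hom hφ ⟨x, hx⟩⟩

/-- The injective dimension can be tested on cyclic modules. -/
lemma hasInjectiveDimensionLT_of_subsingleton_ext_quotient (n : ℕ) (M : ModuleCat.{u} R)
    (h : ∀ I : Ideal R, Subsingleton (Ext.{u} (of R (R ⧸ I)) M (n + 1))) :
    HasInjectiveDimensionLT M (n + 1) := by
  induction n generalizing M with
  | zero =>
    have := injective_of_subsingleton_ext_quotient M h
    infer_instance
  | succ n ih =>
    let ⟨E, _, f, _⟩ := EnoughInjectives.presentation M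
    have hS : (ShortComplex.mk f (Limits.cokernel.π f) (by simp)).ShortExact :=
      { exact := ShortComplex.exact_cokernel f }
    refine (hS.hasInjectiveDimensionLT_X₃_iff n ‹_›).1 (ih _ fun I ↦ ?_)
    refine subsingleton_of_forall_eq 0 fun α ↦ ?_
    have := h I
    obtain ⟨β, rfl⟩ := Ext.covariant_sequence_exact₃ _ hS α rfl (Subsingleton.elim _ _)
    rw [Ext.eq_zero_of_injective β, Ext.zero_comp]

variable [IsNoetherianRing R] [IsLocalRing R]

/-- Nakayama's lemma for `Ext`: if `x` is a nonunit which is regular on `N`, then `Ext N M i`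
vanishes as soon as `Ext (N ⧸ x N) M (i + 1)` does. -/
lemma subsingleton_ext_of_isSMulRegular (N M : ModuleCat.{u} R) [Module.Finite R N]
    [Module.Finite R M] {x : R} (hx : x ∈ IsLocalRing.maximalIdeal R) (hreg : IsSMulRegular N x)
    (i : ℕ) [Subsingleton (Ext.{u} (smulShortComplex N x).X₃ M (i + 1))] :
    Subsingleton (Ext.{u} N M i) := by
  have hsurj (α : Ext.{u} N M i) : ∃ β : Ext.{u} N M i, x • β = α := by
    obtain ⟨β, hβ⟩ : ∃ β : Ext.{u} N M i, (Ext.mk₀ (x • 𝟙 N)).comp β (zero_add i) = α :=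
      Ext.contravariant_sequence_exact₁ hreg.smulShortComplex_shortExact M α
        (add_comm 1 i) (Subsingleton.elim _ _)
    exact ⟨β, by rw [← hβ, Ext.mk₀_smul, Ext.smul_comp, Ext.mk₀_id_comp]⟩
  rw [← Submodule.subsingleton_iff R, ← subsingleton_iff_bot_eq_top, eq_comm]
  refine Submodule.eq_bot_of_le_smul_of_le_jacobson_bot (Ideal.span {x}) _ Module.Finite.fg_top
    (fun α _ ↦ ?_) ?_
  · obtain ⟨β, rfl⟩ := hsurj α
    exact Submodule.smul_mem_smul (Ideal.mem_span_singleton_self x) trivial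
  · rwa [IsLocalRing.jacobson_eq_maximalIdeal _ bot_ne_top, Ideal.span_singleton_le_iff_mem]

open scoped Pointwise in
/-- Over a Noetherian local ring, vanishing of `Ext` on the residue field in all degrees `> n`
implies vanishing on all finite modules in all degrees `> n`. -/
lemma subsingleton_ext_of_residueField (M : ModuleCat.{u} R) [Module.Finite R M] (n : ℕ)
    (h : ∀ i, n < i → Subsingleton (Ext.{u} (of R (IsLocalRing.ResidueField R)) M i))
    (N : Type u) [AddCommGroup N] [Module R N] [hN : Module.Finite R N] (i : ℕ) (hi : n < i) :
    Subsingleton (Ext.{u} (of R N) M i) := by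
  suffices H : ∀ (J : Ideal R) (N : Type u) [AddCommGroup N] [Module R N] [Module.Finite R N],
      J ≤ Module.annihilator R N → ∀ i, n < i → Subsingleton (Ext.{u} (of R N) M i) from
    H ⊥ N bot_le i hi
  clear! N i
  intro J
  induction J using WellFoundedGT.induction with
  | ind J ih =>
  intro N _ _ hN
  induction hN using IsNoetherianRing.induction_on_isQuotientEquivQuotientPrime R with
  | subsingleton N =>
    intro _ i _
    have : Limits.IsZero (of R N) := isZero_of_subsingleton _
    refine subsingleton_of_forall_eq 0 fun α ↦ ?_
    rw [← Ext.mk₀_id_comp α, this.eq_of_src (𝟙 _) 0, Ext.mk₀_zero, Ext.zero_comp]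
  | quotient N q e =>
    intro hJ i hi
    rw [e.annihilator_eq, Ideal.annihilator_quotient] at hJ
    suffices Subsingleton (Ext.{u} (of R (R ⧸ q.1)) M i) from
      subsingleton_ext_of_linearEquiv e.symm M i
    obtain hq | hq := (IsLocalRing.le_maximalIdeal q.2.ne_top).eq_or_lt
    · rw [hq]
      exact h i hi
    obtain ⟨x, hx, hxq⟩ := SetLike.exists_of_lt hq
    have hreg : IsSMulRegular (R ⧸ q.1) x := by
      rw [isSMulRegular_iff_right_eq_zero_of_smul]
      intro y hy
      rw [Algebra.smul_def, mul_eq_zero] at hy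
      exact hy.resolve_left fun h0 ↦ hxq (Ideal.Quotient.eq_zero_iff_mem.1 h0)
    have : Subsingleton (Ext.{u} (smulShortComplex (of R (R ⧸ q.1)) x).X₃ M (i + 1)) := by
      have hlt : J < q.1 ⊔ Ideal.span {x} :=
        hJ.trans_lt (left_lt_sup.2 (by rwa [Ideal.span_singleton_le_iff_mem]))
      refine ih _ hlt ((R ⧸ q.1) ⧸ x • (⊤ : Submodule R (R ⧸ q.1))) ?_ (i + 1) (by lia)
      rw [sup_le_iff, Ideal.span_singleton_le_iff_mem]
      constructor
      · intro y hy
        rw [Module.mem_annihilator]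
        intro m
        obtain ⟨m, rfl⟩ := Submodule.mkQ_surjective _ m
        rw [← map_smul, Algebra.smul_def, Ideal.Quotient.algebraMap_eq,
          Ideal.Quotient.eq_zero_iff_mem.2 hy, zero_mul, map_zero]
      · rw [Module.mem_annihilator]
        intro m
        obtain ⟨m, rfl⟩ := Submodule.mkQ_surjective _ m
        rw [← map_smul, Submodule.mkQ_apply, Submodule.Quotient.mk_eq_zero]
        exact Submodule.smul_mem_pointwise_smul m x ⊤ trivial
    exact subsingleton_ext_of_isSMulRegular (of R (R ⧸ q.1)) M hx hreg i
  | exact N₁ N₂ N₃ f g hf hg hfg h₁ h₃ =>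
    intro hJ i hi
    have := h₁ (hJ.trans (f.annihilator_le_of_injective hf)) i hi
    have := h₃ (hJ.trans (g.annihilator_le_of_surjective hg)) i hi
    let S : ShortComplex (ModuleCat.{u} R) :=
      shortComplexOfCompEqZero f g hfg.linearMap_comp_eq_zero
    exact subsingleton_ext_X₂ (S := S) (shortComplex_shortExact S hfg hf hg) M i

/-- The injective dimension of a finite module over a Noetherian local ring can be tested on the
residue field. -/
lemma hasInjectiveDimensionLT_of_residueField (M : ModuleCat.{u} R) [Module.Finite R M] (n : ℕ)
    (h : ∀ i, n < i → Subsingleton (Ext.{u} (of R (IsLocalRing.ResidueField R)) M i)) :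
    HasInjectiveDimensionLT M (n + 1) :=
  hasInjectiveDimensionLT_of_subsingleton_ext_quotient n M fun I ↦
    subsingleton_ext_of_residueField M n h (R ⧸ I) (n + 1) n.lt_succ_self

end ModuleCat

lemma injDimLE_of_extVanish_residueField {R : Type} [CommRing R] [IsNoetherianRing R]
    [IsLocalRing R] (M : ModuleCat.{0} R) [Module.Finite R M] (n : ℕ)
    (h : ∀ i, n < i → extVanish R (ModuleCat.of R (IsLocalRing.ResidueField R)) M i) :
    injDimLE R M n := by
  intro N i hi
  have := ModuleCat.hasInjectiveDimensionLT_of_residueField M n fun i hi ↦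
    (extVanish_iff_subsingleton_ext _ _ (n.zero_le.trans_lt hi)).1 (h i hi)
  exact (extVanish_iff_subsingleton_ext _ _ (n.zero_le.trans_lt hi)).2
    (HasInjectiveDimensionLT.subsingleton M (n + 1) i hi N)

theorem gorenstein_of_ext_residueField_vanishing
    (R : Type) [CommRing R] [IsNoetherianRing R] [IsLocalRing R] (n : ℕ)
    (h : ∀ i : ℕ, n < i →
      extVanish R (ModuleCat.of R (IsLocalRing.ResidueField R)) (ModuleCat.of R R) i) :
    IsGorensteinRing R ∧
      injDim R (ModuleCat.of R R) =
        sSup {c : ℕ∞ | ∃ i : ℕ, c = i ∧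
          ¬ extVanish R (ModuleCat.of R (IsLocalRing.ResidueField R)) (ModuleCat.of R R) i} := by
  refine ⟨⟨n, injDimLE_of_extVanish_residueField _ n h⟩, le_antisymm ?_ ?_⟩
  · set s := sSup {c : ℕ∞ | ∃ i : ℕ, c = i ∧
      ¬ extVanish R (ModuleCat.of R (IsLocalRing.ResidueField R)) (ModuleCat.of R R) i}
    have hsn : s ≤ n := by
      refine sSup_le ?_
      rintro _ ⟨i, rfl, hi⟩
      exact Nat.cast_le.2 (not_lt.1 fun hlt ↦ hi (h i hlt))
    obtain ⟨m, hm⟩ := ENat.ne_top_iff_exists.1 (ne_top_of_le_ne_top (ENat.natCast_ne_top n) hsn)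
    refine sInf_le ⟨m, hm.symm, injDimLE_of_extVanish_residueField _ m fun i hi ↦ ?_⟩
    by_contra hne
    have hle : (i : ℕ∞) ≤ m := hm ▸ le_sSup ⟨i, rfl, hne⟩
    exact hi.not_ge (Nat.cast_le.1 hle)
  · refine sSup_le ?_
    rintro _ ⟨i, rfl, hi⟩
    refine le_sInf ?_
    rintro _ ⟨m, rfl, hm⟩
    exact Nat.cast_le.2 (not_lt.1 fun hlt ↦ hi (hm _ i hlt))
end

section
/- Let R be a commutative Noetherian local ring and M a nonzero finitely generated R-module of finite injective dimension. If M is reflexive in the derived sense with RHom_R(M,R) cohomologically bounded (i.e., M has finite Gorenstein dimension), then R is Gorenstein. -/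
/-!
STATEMENT 4: Let `R` be a commutative Noetherian local ring and `M` a nonzero finitely
generated `R`-module of finite injective dimension.  If `M` has finite Gorenstein dimension
(equivalently for finitely generated modules: `M` is derived reflexive and `RHom_R(M,R)` is
cohomologically bounded, i.e. `M` admits a finite resolution by totally reflexive modules),
then `R` is Gorenstein.
-/

open CategoryTheory

/-- A finitely generated module `G` is totally reflexive (Gorenstein projective) if the
biduality map `G → G**` is bijective and `Ext^i_R(G,R) = Ext^i_R(G*,R) = 0` for all `i > 0`. -/
def TotallyReflexive (R : Type) [CommRing R] (G : ModuleCat R) : Prop :=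
  Module.Finite R G ∧
  Function.Bijective (Module.Dual.eval R G) ∧
  (∀ i : ℕ, 0 < i →
    extVanish R G (ModuleCat.of R R) i ∧
    extVanish R (ModuleCat.of R (Module.Dual R G)) (ModuleCat.of R R) i)

/-- `GdimLE R n M` : `M` admits a resolution of length at most `n` by totally reflexive
modules, i.e. the Gorenstein dimension of `M` is at most `n`. -/
def GdimLE (R : Type) [CommRing R] : ℕ → ModuleCat R → Prop
  | 0, M => TotallyReflexive R M
  | n + 1, M => TotallyReflexive R M ∨
      ∃ (G : ModuleCat R) (f : G ⟶ M), Epi f ∧ TotallyReflexive R G ∧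
        GdimLE R n (Limits.kernel f)

section ExtVanishing

variable (R : Type) [CommRing R]

/-- Vanishing of `Ext^i_R(N, M)`, for unbundled modules. -/
def EV (N M : Type) [AddCommGroup N] [Module R N] [AddCommGroup M] [Module R M] (i : ℕ) : Prop :=
  Subsingleton (Abelian.Ext (ModuleCat.of R N) (ModuleCat.of R M) i)

variable {R}

theorem extVanish_iff_subsingleton_ext_s4 (X Y : ModuleCat.{0} R) (n : ℕ) :
    extVanish R X Y (n + 1) ↔ Subsingleton (Abelian.Ext X Y (n + 1)) := by
  obtain ⟨P⟩ := (HasProjectiveResolutions.out (C := ModuleCat.{0} R) X).out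
  have e := P.isoExt (R := R) (n + 1) Y
  have h1 : extVanish R X Y (n + 1) ↔
      Limits.IsZero ((P.complex.linearYonedaObj R Y).homology (n + 1)) := by
    rw [← e.isZero_iff, ModuleCat.isZero_iff_subsingleton]
    rfl
  rw [h1, ← HomologicalComplex.exactAt_iff_isZero_homology,
    HomologicalComplex.exactAt_iff' _ n (n + 1) (n + 2) (by simp) (by simp),
    ShortComplex.moduleCat_exact_iff]
  constructor
  · intro h
    refine ⟨fun a b => ?_⟩
    suffices ∀ a : Abelian.Ext X Y (n + 1), a = 0 by rw [this a, this b]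
    intro a
    obtain ⟨f, hf, rfl⟩ := P.extMk_surjective a (n + 2) rfl
    obtain ⟨g, hg⟩ := h f hf
    exact (P.extMk_eq_zero_iff f (n + 2) rfl hf n rfl).2 ⟨g, hg⟩
  · intro h f hf
    obtain ⟨g, hg⟩ := (P.extMk_eq_zero_iff f (n + 2) rfl hf n rfl).1 (Subsingleton.elim _ _)
    exact ⟨g, hg⟩

variable {A B C N M : Type} [AddCommGroup A] [Module R A] [AddCommGroup B] [Module R B]
  [AddCommGroup C] [Module R C] [AddCommGroup N] [Module R N] [AddCommGroup M] [Module R M]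

theorem extVanish_iff_EV (X Y : ModuleCat.{0} R) {n : ℕ} (hn : 0 < n) :
    extVanish R X Y n ↔ EV R X Y n := by
  obtain ⟨n, rfl⟩ := Nat.exists_eq_succ_of_ne_zero hn.ne'
  exact extVanish_iff_subsingleton_ext_s4 X Y n

/-- The short complex attached to a short exact pair of linear maps. -/
theorem exists_shortExact {f : A →ₗ[R] B} {g : B →ₗ[R] C} (hf : Function.Injective f)
    (hg : Function.Surjective g) (hfg : Function.Exact f g) :
    ∃ w : ModuleCat.ofHom f ≫ ModuleCat.ofHom g = 0,
      (ShortComplex.mk (ModuleCat.ofHom f) (ModuleCat.ofHom g) w).ShortExact := by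
  have w : ModuleCat.ofHom f ≫ ModuleCat.ofHom g = 0 := by
    ext x
    exact hfg.apply_apply_eq_zero x
  refine ⟨w, ?_⟩
  apply ModuleCat.shortComplex_shortExact
  · exact hfg
  · exact hf
  · exact hg

theorem EV_iff {i : ℕ} :
    EV R N M i ↔ ∀ x : Abelian.Ext (ModuleCat.of R N) (ModuleCat.of R M) i, x = 0 :=
  ⟨fun h _ => h.elim _ _, fun h => ⟨fun a b => (h a).trans (h b).symm⟩⟩

section ses

variable {f : A →ₗ[R] B} {g : B →ₗ[R] C} (hf : Function.Injective f)
    (hg : Function.Surjective g) (hfg : Function.Exact f g)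
include hf hg hfg

theorem EV.mid_left {i : ℕ} (hA : EV R A M i) (hC : EV R C M i) : EV R B M i := by
  obtain ⟨w, hS⟩ := exists_shortExact hf hg hfg
  rw [EV_iff] at *
  intro x
  obtain ⟨y, rfl⟩ := Abelian.Ext.contravariant_sequence_exact₂ hS _ x (hA _)
  rw [hC y, Abelian.Ext.comp_zero]

theorem EV.fst_left {i : ℕ} (hB : EV R B M i) (hC : EV R C M (i + 1)) : EV R A M i := by
  obtain ⟨w, hS⟩ := exists_shortExact hf hg hfg
  rw [EV_iff] at *
  intro x
  obtain ⟨y, rfl⟩ := Abelian.Ext.contravariant_sequence_exact₁ hS _ x (add_comm 1 i) (hC _)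
  rw [hB y, Abelian.Ext.comp_zero]

theorem EV.trd_left {i : ℕ} (hA : EV R A M i) (hB : EV R B M (i + 1)) : EV R C M (i + 1) := by
  obtain ⟨w, hS⟩ := exists_shortExact hf hg hfg
  rw [EV_iff] at *
  intro x
  obtain ⟨y, rfl⟩ := Abelian.Ext.contravariant_sequence_exact₃ hS _ x (hB _) (add_comm 1 i)
  rw [hA y, Abelian.Ext.comp_zero]

theorem EV.mid_right {i : ℕ} (hA : EV R N A i) (hC : EV R N C i) : EV R N B i := by
  obtain ⟨w, hS⟩ := exists_shortExact hf hg hfg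
  rw [EV_iff] at *
  intro x
  obtain ⟨y, rfl⟩ := Abelian.Ext.covariant_sequence_exact₂ _ hS x (hC _)
  rw [hA y, Abelian.Ext.zero_comp]

theorem EV.fst_right {i : ℕ} (hB : EV R N B (i + 1)) (hC : EV R N C i) : EV R N A (i + 1) := by
  obtain ⟨w, hS⟩ := exists_shortExact hf hg hfg
  rw [EV_iff] at *
  intro x
  obtain ⟨y, rfl⟩ := Abelian.Ext.covariant_sequence_exact₁ _ hS x (hB _) rfl
  rw [hC y, Abelian.Ext.zero_comp]

theorem EV.trd_right {i : ℕ} (hA : EV R N A (i + 1)) (hB : EV R N B i) : EV R N C i := by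
  obtain ⟨w, hS⟩ := exists_shortExact hf hg hfg
  rw [EV_iff] at *
  intro x
  obtain ⟨y, rfl⟩ := Abelian.Ext.covariant_sequence_exact₃ _ hS x rfl (hA _)
  rw [hB y, Abelian.Ext.zero_comp]

/-- If `Ext¹(C, M) = 0`, maps `A → M` extend to `B`. -/
theorem EV.exists_extension (hC : EV R C M 1) (φ : A →ₗ[R] M) : ∃ ψ : B →ₗ[R] M, ψ ∘ₗ f = φ := by
  obtain ⟨w, hS⟩ := exists_shortExact hf hg hfg
  rw [EV_iff] at *
  obtain ⟨y, hy⟩ := Abelian.Ext.contravariant_sequence_exact₁ hS _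
    (Abelian.Ext.mk₀ (ModuleCat.ofHom φ)) (add_comm 1 0) (hC _)
  obtain ⟨ψ, rfl⟩ := Abelian.Ext.addEquiv₀.symm.surjective y
  refine ⟨ψ.hom, ?_⟩
  simp only [Abelian.Ext.addEquiv₀_symm_apply] at hy
  rw [Abelian.Ext.mk₀_comp_mk₀] at hy
  have := (Abelian.Ext.mk₀_bijective _ _).injective hy
  exact congrArg ModuleCat.Hom.hom this

/-- If `Ext¹(N, A) = 0`, maps `N → C` lift to `B`. -/
theorem EV.exists_lift (hA : EV R N A 1) (φ : N →ₗ[R] C) : ∃ ψ : N →ₗ[R] B, g ∘ₗ ψ = φ := by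
  obtain ⟨w, hS⟩ := exists_shortExact hf hg hfg
  rw [EV_iff] at *
  obtain ⟨y, hy⟩ := Abelian.Ext.covariant_sequence_exact₃ _ hS
    (Abelian.Ext.mk₀ (ModuleCat.ofHom φ)) rfl (hA _)
  obtain ⟨ψ, rfl⟩ := Abelian.Ext.addEquiv₀.symm.surjective y
  refine ⟨ψ.hom, ?_⟩
  simp only [Abelian.Ext.addEquiv₀_symm_apply] at hy
  rw [Abelian.Ext.mk₀_comp_mk₀] at hy
  have := (Abelian.Ext.mk₀_bijective _ _).injective hy
  exact congrArg ModuleCat.Hom.hom this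

theorem EV.one_of_extensions (hB : EV R B M 1)
    (h : ∀ φ : A →ₗ[R] M, ∃ ψ : B →ₗ[R] M, ψ ∘ₗ f = φ) : EV R C M 1 := by
  obtain ⟨w, hS⟩ := exists_shortExact hf hg hfg
  rw [EV_iff] at *
  intro x
  obtain ⟨y, rfl⟩ := Abelian.Ext.contravariant_sequence_exact₃ hS _ x (hB _) (add_comm 1 0)
  obtain ⟨φ, rfl⟩ := Abelian.Ext.addEquiv₀.symm.surjective y
  obtain ⟨ψ, hψ⟩ := h φ.hom
  have : φ = ModuleCat.ofHom f ≫ ModuleCat.ofHom ψ := by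
    ext x; exact (LinearMap.congr_fun hψ x).symm
  simp only [Abelian.Ext.addEquiv₀_symm_apply]
  rw [this, ← Abelian.Ext.mk₀_comp_mk₀]
  exact hS.extClass_comp_assoc _

theorem EV.one_of_lifts (hB : EV R N B 1)
    (h : ∀ φ : N →ₗ[R] C, ∃ ψ : N →ₗ[R] B, g ∘ₗ ψ = φ) : EV R N A 1 := by
  obtain ⟨w, hS⟩ := exists_shortExact hf hg hfg
  rw [EV_iff] at *
  intro x
  obtain ⟨y, rfl⟩ := Abelian.Ext.covariant_sequence_exact₁ _ hS x (hB _) (zero_add 1)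
  obtain ⟨φ, rfl⟩ := Abelian.Ext.addEquiv₀.symm.surjective y
  obtain ⟨ψ, hψ⟩ := h φ.hom
  have : φ = ModuleCat.ofHom ψ ≫ ModuleCat.ofHom g := by
    ext x; exact (LinearMap.congr_fun hψ x).symm
  simp only [Abelian.Ext.addEquiv₀_symm_apply]
  rw [this, ← Abelian.Ext.mk₀_comp_mk₀, Abelian.Ext.comp_assoc_of_second_deg_zero,
    hS.comp_extClass, Abelian.Ext.comp_zero]

end ses

theorem EV.of_projective [Module.Projective R N] {i : ℕ} (hi : 0 < i) : EV R N M i := by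
  obtain ⟨i, rfl⟩ := Nat.exists_eq_succ_of_ne_zero hi.ne'
  have : Projective (ModuleCat.of R N) := (IsProjective.iff_projective N).1 inferInstance
  rw [EV_iff]
  intro x
  exact x.eq_zero_of_projective

theorem EV.of_injective (hM : Module.Injective R M) {i : ℕ} (hi : 0 < i) : EV R N M i := by
  obtain ⟨i, rfl⟩ := Nat.exists_eq_succ_of_ne_zero hi.ne'
  have : Injective (ModuleCat.of R M) := Module.injective_object_of_injective_module R M
  rw [EV_iff]
  intro x
  exact x.eq_zero_of_injective

theorem EV.of_subsingleton_left [Subsingleton N] {i : ℕ} : EV R N M i := by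
  have : Limits.IsZero (ModuleCat.of R N) := ModuleCat.isZero_of_subsingleton _
  rw [EV_iff]
  intro x
  rw [← Abelian.Ext.mk₀_id_comp x, this.eq_of_src (𝟙 _) 0, Abelian.Ext.mk₀_zero,
    Abelian.Ext.zero_comp]

theorem EV.of_subsingleton_right [Subsingleton M] {i : ℕ} : EV R N M i := by
  have : Limits.IsZero (ModuleCat.of R M) := ModuleCat.isZero_of_subsingleton _
  rw [EV_iff]
  intro x
  rw [← Abelian.Ext.comp_mk₀_id x, this.eq_of_src (𝟙 _) 0, Abelian.Ext.mk₀_zero,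
    Abelian.Ext.comp_zero]

theorem EV.congr_left {i : ℕ} (e : A ≃ₗ[R] B) (h : EV R A M i) : EV R B M i :=
  EV.mid_left (f := e.toLinearMap) (g := (0 : B →ₗ[R] PUnit)) e.injective
    (fun _ => ⟨0, Subsingleton.elim _ _⟩) (fun x => ⟨fun _ => e.surjective x, fun _ => rfl⟩) h
    EV.of_subsingleton_left

theorem EV.congr_right {i : ℕ} (e : A ≃ₗ[R] B) (h : EV R N A i) : EV R N B i :=
  EV.mid_right (f := e.toLinearMap) (g := (0 : B →ₗ[R] PUnit)) e.injective
    (fun _ => ⟨0, Subsingleton.elim _ _⟩) (fun x => ⟨fun _ => e.surjective x, fun _ => rfl⟩) h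
    EV.of_subsingleton_right

end ExtVanishing

section TotallyReflexive

variable {R : Type} [CommRing R]
variable {A B C : Type} [AddCommGroup A] [Module R A] [AddCommGroup B] [Module R B]
  [AddCommGroup C] [Module R C]

theorem LinearMap.exists_comp_eq_of_surjective {g : B →ₗ[R] C} (hg : Function.Surjective g)
    (φ : B →ₗ[R] A) (h : LinearMap.ker g ≤ LinearMap.ker φ) : ∃ ψ : C →ₗ[R] A, ψ ∘ₗ g = φ := by
  refine ⟨(LinearMap.ker g).liftQ φ h ∘ₗ (g.quotKerEquivOfSurjective hg).symm.toLinearMap, ?_⟩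
  ext x
  have : (g.quotKerEquivOfSurjective hg).symm (g x) = (LinearMap.ker g).mkQ x := by
    rw [LinearEquiv.symm_apply_eq]; rfl
  simp [this]

theorem LinearMap.exact_dualMap {f : A →ₗ[R] B} {g : B →ₗ[R] C}
    (hg : Function.Surjective g) (hfg : Function.Exact f g) :
    Function.Exact g.dualMap f.dualMap := by
  intro φ
  constructor
  · intro h
    obtain ⟨ψ, hψ⟩ := LinearMap.exists_comp_eq_of_surjective hg φ (by
      intro x hx
      obtain ⟨y, rfl⟩ := (hfg x).1 hx
      exact LinearMap.congr_fun h y)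
    exact ⟨ψ, hψ⟩
  · rintro ⟨ψ, rfl⟩
    ext x
    simp [hfg.apply_apply_eq_zero]

theorem EV.dualMap_surjective {f : A →ₗ[R] B} {g : B →ₗ[R] C} (hf : Function.Injective f)
    (hg : Function.Surjective g) (hfg : Function.Exact f g) (h : EV R C R 1) :
    Function.Surjective f.dualMap :=
  fun φ => h.exists_extension hf hg hfg φ

variable (R) in
/-- Totally reflexive modules, in unbundled form. -/
structure TotRefl (G : Type) [AddCommGroup G] [Module R G] : Prop where
  finite : Module.Finite R G
  reflexive : Module.IsReflexive R G
  ext_self (i : ℕ) (hi : 0 < i) : EV R G R i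
  ext_dual (i : ℕ) (hi : 0 < i) : EV R (Module.Dual R G) R i

theorem TotallyReflexive.totRefl {G : ModuleCat.{0} R} (h : TotallyReflexive R G) :
    TotRefl R G where
  finite := h.1
  reflexive := ⟨h.2.1⟩
  ext_self i hi := (extVanish_iff_EV _ _ hi).1 (h.2.2 i hi).1
  ext_dual i hi := (extVanish_iff_EV _ _ hi).1 (h.2.2 i hi).2

theorem TotRefl.congr (e : A ≃ₗ[R] B) (h : TotRefl R A) : TotRefl R B where
  finite := have := h.finite; Module.Finite.equiv e
  reflexive := have := h.reflexive; Module.equiv e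
  ext_self i hi := (h.ext_self i hi).congr_left e
  ext_dual i hi := (h.ext_dual i hi).congr_left e.symm.dualMap

variable [IsNoetherianRing R]

theorem TotRefl.dual (h : TotRefl R A) : TotRefl R (Module.Dual R A) where
  finite := by have := h.finite; infer_instance
  reflexive := have := h.reflexive; inferInstance
  ext_self := h.ext_dual
  ext_dual i hi := have := h.reflexive; (h.ext_self i hi).congr_left (Module.evalEquiv R A)

theorem TotRefl.ker {F : Type} [AddCommGroup F] [Module R F] [Module.Finite R F] [Module.Free R F]
    (p : F →ₗ[R] A) (hp : Function.Surjective p) (h : TotRefl R A) :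
    TotRefl R (LinearMap.ker p) := by
  have hf : Function.Injective (LinearMap.ker p).subtype := Subtype.val_injective
  have hfg : Function.Exact (LinearMap.ker p).subtype p := p.exact_subtype_ker_map
  have hsurj := (h.ext_self 1 one_pos).dualMap_surjective hf hp hfg
  have hinj : Function.Injective p.dualMap := LinearMap.dualMap_injective_of_surjective hp
  have hex := LinearMap.exact_dualMap hp hfg
  refine ⟨inferInstance, ⟨?_, ?_⟩, ?_, ?_⟩
  · rw [injective_iff_map_eq_zero]
    intro x hx
    have : Module.Dual.eval R F x = 0 := by
      ext φ
      exact LinearMap.congr_fun hx (φ ∘ₗ (LinearMap.ker p).subtype)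
    exact Subtype.ext ((Module.bijective_dual_eval R F).1 (this.trans (map_zero _).symm))
  · intro lam
    obtain ⟨x, hx⟩ := (Module.bijective_dual_eval R F).2
      (lam ∘ₗ (LinearMap.ker p).subtype.dualMap)
    have hx' : p x = 0 := by
      have := h.reflexive
      apply (Module.bijective_dual_eval R A).1
      rw [map_zero]
      ext δ
      have h1 := LinearMap.congr_fun hx (p.dualMap δ)
      have h2 : (LinearMap.ker p).subtype.dualMap (p.dualMap δ) = 0 :=
        hex.apply_apply_eq_zero δ
      simpa [h2] using h1
    refine ⟨⟨x, hx'⟩, ?_⟩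
    ext φ
    obtain ⟨ψ, rfl⟩ := hsurj φ
    exact LinearMap.congr_fun hx ψ
  · intro i hi
    exact EV.fst_left hf hp hfg (EV.of_projective hi) (h.ext_self _ (Nat.succ_pos _))
  · rintro (_ | _ | i) hi
    · exact absurd hi (lt_irrefl _)
    · refine EV.one_of_extensions hinj hsurj hex (EV.of_projective hi) fun φ => ?_
      have := h.reflexive
      obtain ⟨d, rfl⟩ := (Module.bijective_dual_eval R A).2 φ
      obtain ⟨x, rfl⟩ := hp d
      exact ⟨Module.Dual.eval R F x, rfl⟩
    · exact EV.trd_left hinj hsurj hex (h.ext_dual _ (Nat.succ_pos _)) (EV.of_projective hi)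

theorem TotRefl.exists_cosyzygy (h : TotRefl R A) :
    ∃ (n : ℕ) (f : A →ₗ[R] (Fin n → R)), Function.Injective f ∧
      TotRefl R ((Fin n → R) ⧸ LinearMap.range f) := by
  have := h.reflexive
  have := h.dual.finite
  obtain ⟨n, p, hp⟩ := Module.Finite.exists_fin' R (Module.Dual R A)
  have hex := LinearMap.exact_dualMap hp p.exact_subtype_ker_map
  have hsurj := (h.dual.ext_self 1 one_pos).dualMap_surjective
    (f := (LinearMap.ker p).subtype) Subtype.val_injective hp p.exact_subtype_ker_map
  have hL := (TotRefl.ker p hp h.dual).dual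
  let e := (Pi.basisFun R (Fin n)).toDualEquiv.symm
  let f : A →ₗ[R] (Fin n → R) :=
    e.toLinearMap ∘ₗ p.dualMap ∘ₗ (Module.evalEquiv R A).toLinearMap
  refine ⟨n, f, e.injective.comp ((LinearMap.dualMap_injective_of_surjective hp).comp
    (Module.evalEquiv R A).injective), ?_⟩
  let g : (Fin n → R) →ₗ[R] Module.Dual R (LinearMap.ker p) :=
    (LinearMap.ker p).subtype.dualMap ∘ₗ e.symm.toLinearMap
  have hg : Function.Surjective g := hsurj.comp e.symm.surjective
  have hk : LinearMap.range f = LinearMap.ker g := by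
    ext x
    constructor
    · rintro ⟨a, rfl⟩
      simp only [f, g, LinearMap.mem_ker, LinearMap.comp_apply, LinearEquiv.coe_coe,
        LinearEquiv.symm_apply_apply]
      exact hex.apply_apply_eq_zero _
    · intro hx
      obtain ⟨y, hy⟩ := (hex (e.symm x)).1 hx
      refine ⟨(Module.evalEquiv R A).symm y, ?_⟩
      change e (p.dualMap (Module.evalEquiv R A ((Module.evalEquiv R A).symm y))) = x
      rw [LinearEquiv.apply_symm_apply, hy, LinearEquiv.apply_symm_apply]
  rw [hk]
  exact hL.congr (g.quotKerEquivOfSurjective hg).symm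

theorem TotRefl.extension {f : A →ₗ[R] B} {g : B →ₗ[R] C} (hf : Function.Injective f)
    (hg : Function.Surjective g) (hfg : Function.Exact f g) (hA : TotRefl R A)
    (hC : TotRefl R C) : TotRefl R B := by
  have := hA.finite
  have := hC.finite
  have := hA.reflexive
  have := hC.reflexive
  have hsurj := (hC.ext_self 1 one_pos).dualMap_surjective hf hg hfg
  have hinj : Function.Injective g.dualMap := LinearMap.dualMap_injective_of_surjective hg
  have hex := LinearMap.exact_dualMap hg hfg
  refine ⟨?_, ⟨?_, ?_⟩, ?_, ?_⟩
  · have : IsNoetherian R B := isNoetherian_of_range_eq_ker f g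
      (LinearMap.exact_iff.1 hfg).symm
    infer_instance
  · rw [injective_iff_map_eq_zero]
    intro b hb
    have h1 : g b = 0 := by
      apply (Module.bijective_dual_eval R C).1
      rw [map_zero]
      ext φ
      exact LinearMap.congr_fun hb (φ ∘ₗ g)
    obtain ⟨a, rfl⟩ := (hfg b).1 h1
    have h2 : a = 0 := by
      apply (Module.bijective_dual_eval R A).1
      rw [map_zero]
      ext φ
      obtain ⟨ψ, rfl⟩ := hsurj φ
      exact LinearMap.congr_fun hb ψ
    rw [h2, map_zero]
  · intro lam
    obtain ⟨c, hc⟩ := (Module.bijective_dual_eval R C).2 (lam ∘ₗ g.dualMap)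
    obtain ⟨b, rfl⟩ := hg c
    obtain ⟨μ, hμ⟩ := LinearMap.exists_comp_eq_of_surjective hsurj
      (lam - Module.Dual.eval R B b) (by
        intro φ hφ
        obtain ⟨ψ, rfl⟩ := (hex φ).1 hφ
        have := LinearMap.congr_fun hc ψ
        simp only [LinearMap.mem_ker, LinearMap.sub_apply]
        rw [sub_eq_zero]
        exact this.symm)
    obtain ⟨a, rfl⟩ := (Module.bijective_dual_eval R A).2 μ
    refine ⟨f a + b, ?_⟩
    rw [map_add, ← eq_sub_iff_add_eq, ← hμ]
    rfl
  · intro i hi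
    exact EV.mid_left hf hg hfg (hA.ext_self i hi) (hC.ext_self i hi)
  · intro i hi
    exact EV.mid_left hinj hsurj hex (hC.ext_dual i hi) (hA.ext_dual i hi)

theorem TotRefl.EV_of_injDim {M : Type} [AddCommGroup M] [Module R M] {b : ℕ}
    (hM : ∀ (N : Type) [AddCommGroup N] [Module R N] (i : ℕ), b < i → EV R N M i)
    (h : TotRefl R A) {i : ℕ} (hi : 0 < i) : EV R A M i := by
  suffices ∀ (c : ℕ) (G : Type) [AddCommGroup G] [Module R G] (_ : TotRefl R G) (i : ℕ), 0 < i →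
      b < i + c → EV R G M i from this (b + 1) A h i hi (by omega)
  intro c
  induction c with
  | zero => intro G _ _ _ i _ hb; exact hM G i hb
  | succ c ih =>
    intro G _ _ hG i hi hb
    obtain ⟨n, f, hf, hQ⟩ := hG.exists_cosyzygy
    exact EV.fst_left hf (Submodule.mkQ_surjective _) (LinearMap.exact_map_mkQ_range f)
      (EV.of_projective hi) (ih _ hQ (i + 1) (Nat.succ_pos _) (by omega))

end TotallyReflexive

section GorensteinApproximation

variable {R : Type} [CommRing R] [IsNoetherianRing R]

/-- The pushout of `G ← K → H` for `K → G` injective with cokernel `M` and `K → H` injective with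
totally reflexive cokernel `X`: there is a module `P` with `0 → H → P → M → 0` exact and `P`
totally reflexive. -/
theorem TotRefl.exists_pushout {K G H X M : Type} [AddCommGroup K] [Module R K] [AddCommGroup G]
    [Module R G] [AddCommGroup H] [Module R H] [AddCommGroup X] [Module R X] [AddCommGroup M]
    [Module R M] {i : K →ₗ[R] G} {p : G →ₗ[R] M} {a : K →ₗ[R] H} {b : H →ₗ[R] X}
    (hi : Function.Injective i) (hp : Function.Surjective p) (hip : Function.Exact i p)
    (ha : Function.Injective a) (hb : Function.Surjective b) (hab : Function.Exact a b)
    (hG : TotRefl R G) (hX : TotRefl R X) :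
    ∃ (P : Type) (_ : AddCommGroup P) (_ : Module R P) (j : H →ₗ[R] P) (q : P →ₗ[R] M),
      Function.Injective j ∧ Function.Surjective q ∧ Function.Exact j q ∧ TotRefl R P := by
  let r : K →ₗ[R] G × H := i.prod (-a)
  let P := (G × H) ⧸ LinearMap.range r
  let j : H →ₗ[R] P := (LinearMap.range r).mkQ ∘ₗ LinearMap.inr R G H
  let l : G →ₗ[R] P := (LinearMap.range r).mkQ ∘ₗ LinearMap.inl R G H
  let q : P →ₗ[R] M := (LinearMap.range r).liftQ (p ∘ₗ LinearMap.fst R G H) (by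
    rintro _ ⟨k, rfl⟩
    exact hip.apply_apply_eq_zero k)
  let t : P →ₗ[R] X := (LinearMap.range r).liftQ (b ∘ₗ LinearMap.snd R G H) (by
    rintro _ ⟨k, rfl⟩
    simp [r, hab.apply_apply_eq_zero])
  have hmk (g : G) (h : H) : (Submodule.Quotient.mk (g, h) : P) = l g + j h := by
    change _ = (Submodule.Quotient.mk ((g, 0) + (0, h)) : P)
    rw [Prod.mk_add_mk, add_zero, zero_add]
  have hrel (k : K) : l (i k) = j (a k) := by
    rw [← sub_eq_zero]
    have : (Submodule.Quotient.mk (r k) : P) = 0 :=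
      (Submodule.Quotient.mk_eq_zero _).2 ⟨k, rfl⟩
    rw [← this, show r k = (i k, - a k) from rfl, hmk, map_neg, sub_eq_add_neg]
  have hqj (h : H) : q (j h) = 0 := map_zero p
  have hql (g : G) : q (l g) = p g := rfl
  have htj (h : H) : t (j h) = b h := rfl
  have htl (g : G) : t (l g) = 0 := map_zero b
  refine ⟨P, inferInstance, inferInstance, j, q, ?_, ?_, ?_, ?_⟩
  · rw [injective_iff_map_eq_zero]
    intro h hh
    obtain ⟨k, hk⟩ := (Submodule.Quotient.mk_eq_zero _).1 hh
    have h1 : i k = 0 := congrArg Prod.fst hk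
    have h2 : -a k = h := congrArg Prod.snd hk
    rw [← h2, hi (h1.trans (map_zero i).symm), map_zero, neg_zero]
  · intro m
    obtain ⟨g, rfl⟩ := hp m
    exact ⟨l g, hql g⟩
  · intro x
    constructor
    · intro hx
      obtain ⟨⟨g, h⟩, rfl⟩ := Submodule.Quotient.mk_surjective _ x
      rw [hmk, map_add, hqj, hql, add_zero] at hx
      obtain ⟨k, rfl⟩ := (hip g).1 hx
      exact ⟨a k + h, by rw [hmk, hrel, map_add]⟩
    · rintro ⟨h, rfl⟩
      exact hqj h
  · refine TotRefl.extension (f := l) (g := t) ?_ ?_ ?_ hG hX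
    · rw [injective_iff_map_eq_zero]
      intro g hg
      obtain ⟨k, hk⟩ := (Submodule.Quotient.mk_eq_zero _).1 hg
      have h1 : i k = g := congrArg Prod.fst hk
      have h2 : -a k = 0 := congrArg Prod.snd hk
      rw [neg_eq_zero] at h2
      rw [← h1, ha (h2.trans (map_zero a).symm), map_zero]
    · intro x
      obtain ⟨h, rfl⟩ := hb x
      exact ⟨j h, htj h⟩
    · intro x
      constructor
      · intro hx
        obtain ⟨⟨g, h⟩, rfl⟩ := Submodule.Quotient.mk_surjective _ x
        rw [hmk, map_add, htj, htl, zero_add] at hx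
        obtain ⟨k, rfl⟩ := (hab h).1 hx
        exact ⟨g + i k, by rw [hmk, map_add, hrel]⟩
      · rintro ⟨g, rfl⟩
        exact htl g

variable (R) in
/-- `M` embeds in a module of projective dimension at most `n` with totally reflexive cokernel. -/
def HasPdHull (n : ℕ) (M : Type) [AddCommGroup M] [Module R M] : Prop :=
  ∃ (H : Type) (_ : AddCommGroup H) (_ : Module R H) (X : Type) (_ : AddCommGroup X)
    (_ : Module R X) (f : M →ₗ[R] H) (g : H →ₗ[R] X), Function.Injective f ∧
    Function.Surjective g ∧ Function.Exact f g ∧ TotRefl R X ∧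
    HasProjectiveDimensionLT (ModuleCat.of R H) (n + 1)

theorem TotRefl.hasPdHull {G : Type} [AddCommGroup G] [Module R G] (h : TotRefl R G) (n : ℕ) :
    HasPdHull R n G := by
  obtain ⟨m, f, hf, hQ⟩ := h.exists_cosyzygy
  refine ⟨_, _, _, _, _, _, f, _, hf, Submodule.mkQ_surjective _,
    LinearMap.exact_map_mkQ_range f, hQ, ?_⟩
  have : Projective (ModuleCat.of R (Fin m → R)) :=
    (IsProjective.iff_projective _).1 inferInstance
  have : HasProjectiveDimensionLT (ModuleCat.of R (Fin m → R)) 1 :=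
    projective_iff_hasProjectiveDimensionLT_one.1 this
  exact hasProjectiveDimensionLT_of_ge _ 1 (n + 1) (by omega)

theorem HasPdHull.step {K G M : Type} [AddCommGroup K] [Module R K] [AddCommGroup G]
    [Module R G] [AddCommGroup M] [Module R M] {i : K →ₗ[R] G} {p : G →ₗ[R] M}
    (hi : Function.Injective i) (hp : Function.Surjective p) (hip : Function.Exact i p)
    (hG : TotRefl R G) {n : ℕ} (hK : HasPdHull R n K) : HasPdHull R (n + 1) M := by
  obtain ⟨H, _, _, X, _, _, a, b, ha, hb, hab, hX, hH⟩ := hK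
  obtain ⟨P, _, _, j, q, hj, hq, hjq, hP⟩ :=
    TotRefl.exists_pushout hi hp hip ha hb hab hG hX
  obtain ⟨m, u, hu, hQ⟩ := hP.exists_cosyzygy
  let v := u ∘ₗ j
  have hv : Function.Injective v := hu.comp hj
  have hvu : LinearMap.range v ≤ LinearMap.range u := LinearMap.range_comp_le_range _ _
  obtain ⟨α, hα⟩ := LinearMap.exists_comp_eq_of_surjective hq ((LinearMap.range v).mkQ ∘ₗ u) (by
    intro x hx
    obtain ⟨h, rfl⟩ := (hjq x).1 hx
    exact (Submodule.Quotient.mk_eq_zero _).2 ⟨h, rfl⟩)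
  have hα' (x : P) : α (q x) = (LinearMap.range v).mkQ (u x) := LinearMap.congr_fun hα x
  refine ⟨_, _, _, _, _, _, α, Submodule.factor hvu, ?_, Submodule.factor_surjective hvu, ?_,
    hQ, ?_⟩
  · rw [injective_iff_map_eq_zero]
    intro x hx
    obtain ⟨x, rfl⟩ := hq x
    rw [hα'] at hx
    obtain ⟨h, hh⟩ := (Submodule.Quotient.mk_eq_zero _).1 hx
    rw [← hu hh]
    exact hjq.apply_apply_eq_zero h
  · intro x
    obtain ⟨x, rfl⟩ := Submodule.mkQ_surjective _ x
    constructor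
    · intro hx
      obtain ⟨y, rfl⟩ := (Submodule.Quotient.mk_eq_zero _).1 hx
      exact ⟨q y, hα' y⟩
    · rintro ⟨y, hy⟩
      obtain ⟨y, rfl⟩ := hq y
      rw [← hy, hα']
      exact (Submodule.Quotient.mk_eq_zero _).2 ⟨y, rfl⟩
  · obtain ⟨w, hS⟩ := exists_shortExact hv (Submodule.mkQ_surjective _)
      (LinearMap.exact_map_mkQ_range v)
    have h2 : Projective (ModuleCat.of R (Fin m → R)) :=
      (IsProjective.iff_projective _).1 inferInstance
    exact (hS.hasProjectiveDimensionLT_X₃_iff n h2).2 hH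

theorem GdimLE.hasPdHull {n : ℕ} {M : ModuleCat.{0} R} (h : GdimLE R n M) : HasPdHull R n M := by
  induction n generalizing M with
  | zero => exact TotRefl.hasPdHull (TotallyReflexive.totRefl h) 0
  | succ n ih =>
    obtain h | ⟨G, f, hf, hG, hK⟩ := h
    · exact TotRefl.hasPdHull h.totRefl _
    · refine HasPdHull.step (i := (Limits.kernel.ι f).hom) (p := f.hom) ?_ ?_ ?_ hG.totRefl (ih hK)
      · exact (ModuleCat.mono_iff_injective _).1 inferInstance
      · exact (ModuleCat.epi_iff_surjective _).1 hf
      · have := ShortComplex.exact_kernel f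
        exact (ShortComplex.ShortExact.moduleCat_exact_iff_function_exact _).1 this

/-- A module of finite injective dimension and finite G-dimension has finite projective
dimension. -/
theorem HasPdHull.hasProjectiveDimensionLT {M : Type} [AddCommGroup M] [Module R M] {n b : ℕ}
    (hM : ∀ (N : Type) [AddCommGroup N] [Module R N] (i : ℕ), b < i → EV R N M i)
    (h : HasPdHull R n M) : HasProjectiveDimensionLT (ModuleCat.of R M) (n + 1) := by
  obtain ⟨H, _, _, X, _, _, f, g, hf, hg, hfg, hX, hH⟩ := h
  obtain ⟨ψ, hψ⟩ := (hX.EV_of_injDim hM one_pos).exists_extension hf hg hfg LinearMap.id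
  have : Retract (ModuleCat.of R M) (ModuleCat.of R H) :=
    { i := ModuleCat.ofHom f
      r := ModuleCat.ofHom ψ
      retract := by rw [← ModuleCat.ofHom_comp, hψ]; rfl }
  exact this.hasProjectiveDimensionLT _

end GorensteinApproximation

section ResidueField

variable {R : Type} [CommRing R] [IsNoetherianRing R] [IsLocalRing R]
variable {N M : Type} [AddCommGroup N] [Module R N] [AddCommGroup M] [Module R M]

open IsLocalRing

theorem EV.of_quotient_smul [Module.Finite R N] [Module.Finite R M] {x : R}
    (hx : x ∈ maximalIdeal R) (hinj : Function.Injective (x • LinearMap.id : N →ₗ[R] N)) {i : ℕ}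
    (h : EV R (N ⧸ LinearMap.range (x • LinearMap.id : N →ₗ[R] N)) M (i + 1)) : EV R N M i := by
  obtain ⟨w, hS⟩ := exists_shortExact hinj (Submodule.mkQ_surjective _)
    (LinearMap.exact_map_mkQ_range _)
  rw [EV_iff] at h
  have key : (⊤ : Submodule R (Abelian.Ext (ModuleCat.of R N) (ModuleCat.of R M) i)) ≤
      maximalIdeal R • ⊤ := by
    intro y _
    obtain ⟨z, rfl⟩ := Abelian.Ext.contravariant_sequence_exact₁ hS _ y (add_comm 1 i) (h _)
    have h2 (z : Abelian.Ext (ModuleCat.of R N) (ModuleCat.of R M) i) :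
        (Abelian.Ext.mk₀ (ModuleCat.ofHom (x • LinearMap.id : N →ₗ[R] N))).comp z
        (zero_add i) = x • z := by
      change (Abelian.Ext.mk₀ (x • 𝟙 (ModuleCat.of R N))).comp z (zero_add i) = x • z
      rw [Abelian.Ext.mk₀_smul, Abelian.Ext.smul_comp, Abelian.Ext.mk₀_id_comp]
    exact h2 z ▸ Submodule.smul_mem_smul hx trivial
  have hfin : Module.Finite R (Abelian.Ext (ModuleCat.of R N) (ModuleCat.of R M) i) :=
    ModuleCat.finite_ext _ _ _ _
  have hbot := Submodule.eq_bot_of_le_smul_of_le_jacobson_bot _ _ hfin.1 key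
    (IsLocalRing.maximalIdeal_le_jacobson _)
  rw [EV_iff]
  intro y
  exact (Submodule.mem_bot R).1 (hbot ▸ Submodule.mem_top)

/-- If `Ext^i(k, M) = 0` for all `i > b`, then `Ext^i(N, M) = 0` for all finitely generated `N`
and all `i > b`. -/
theorem EV.of_residueField [Module.Finite R M] {b : ℕ}
    (h : ∀ i, b < i → EV R (R ⧸ maximalIdeal R) M i) [Module.Finite R N] {i : ℕ} (hi : b < i) :
    EV R N M i := by
  suffices ∀ (J : Ideal R) (N : Type) [AddCommGroup N] [Module R N] [Module.Finite R N],
      J ≤ Module.annihilator R N → ∀ i, b < i → EV R N M i from this ⊥ N bot_le i hi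
  clear hi i
  intro J
  induction J using IsNoetherian.induction with
  | hgt J ih =>
  intro N _ _ hN
  induction hN using IsNoetherianRing.induction_on_isQuotientEquivQuotientPrime R with
  | subsingleton N => exact fun _ _ _ => EV.of_subsingleton_left
  | exact N₁ N₂ N₃ f g hf hg hfg h₁ h₃ =>
    intro hJ i hi
    exact EV.mid_left hf hg hfg (h₁ (hJ.trans (LinearMap.annihilator_le_of_injective f hf)) i hi)
      (h₃ (hJ.trans (LinearMap.annihilator_le_of_surjective g hg)) i hi)
  | quotient N p e =>
    intro hJ i hi
    refine EV.congr_left e.symm ?_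
    rw [e.annihilator_eq, Ideal.annihilator_quotient] at hJ
    obtain hlt | rfl := hJ.lt_or_eq
    · exact ih _ hlt _ (Ideal.annihilator_quotient).ge i hi
    by_cases hp : p.1 = maximalIdeal R
    · rw [hp]; exact h i hi
    obtain ⟨x, hx, hxp⟩ := SetLike.exists_of_lt
      (lt_of_le_of_ne (le_maximalIdeal p.2.ne_top) hp)
    have hinj : Function.Injective (x • LinearMap.id : (R ⧸ p.1) →ₗ[R] (R ⧸ p.1)) := by
      rw [injective_iff_map_eq_zero]
      intro a ha
      obtain ⟨a, rfl⟩ := Ideal.Quotient.mk_surjective a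
      have : Ideal.Quotient.mk p.1 (x * a) = 0 := ha
      rw [Ideal.Quotient.eq_zero_iff_mem] at this ⊢
      exact (p.2.mem_or_mem this).resolve_left hxp
    refine EV.of_quotient_smul hx hinj (ih (p.1 ⊔ Ideal.span {x}) ?_ _ ?_ _ (by omega))
    · refine lt_of_le_of_ne le_sup_left fun heq => hxp ?_
      rw [heq]
      exact Ideal.mem_sup_right (Ideal.mem_span_singleton_self x)
    · refine sup_le ((Ideal.annihilator_quotient (I := p.1)).ge.trans
        (LinearMap.annihilator_le_of_surjective _ (Submodule.mkQ_surjective _))) ?_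
      rw [Ideal.span_singleton_le_iff_mem, Module.mem_annihilator]
      intro a
      obtain ⟨a, rfl⟩ := Submodule.mkQ_surjective _ a
      rw [← map_smul]
      exact (Submodule.Quotient.mk_eq_zero _).2 ⟨a, rfl⟩

end ResidueField

section InjectiveSequences

variable {R : Type} [CommRing R]

theorem Module.Injective.of_retract {X Y : Type} [AddCommGroup X] [Module R X] [AddCommGroup Y]
    [Module R Y] (hX : Module.Injective R X) (i : Y →ₗ[R] X) (r : X →ₗ[R] Y)
    (h : r ∘ₗ i = LinearMap.id) : Module.Injective R Y where
  out A B _ _ _ _ f hf g := by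
    obtain ⟨l, hl⟩ := hX.out f hf (i ∘ₗ g)
    refine ⟨r ∘ₗ l, fun a => ?_⟩
    simpa [hl] using LinearMap.congr_fun h (g a)

theorem Module.Injective.of_surjective {X Y : Type} [AddCommGroup X] [Module R X]
    [AddCommGroup Y] [Module R Y] (hX : Module.Injective R X) (s : X →ₗ[R] Y)
    (hs : Function.Surjective s) (hk : Module.Injective R (LinearMap.ker s)) :
    Module.Injective R Y := by
  obtain ⟨r, hr⟩ := hk.out (LinearMap.ker s).subtype Subtype.val_injective LinearMap.id
  obtain ⟨i, hi⟩ := LinearMap.exists_comp_eq_of_surjective hs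
    (LinearMap.id - (LinearMap.ker s).subtype ∘ₗ r) (by
      intro x hx
      have := congrArg Subtype.val (hr ⟨x, hx⟩)
      simpa [sub_eq_zero] using this.symm)
  refine hX.of_retract i s ?_
  ext y
  obtain ⟨x, rfl⟩ := hs y
  have h1 : i (s x) = x - (r x : X) := LinearMap.congr_fun hi x
  simp [h1]

theorem Module.Injective.of_equiv {X Y : Type} [AddCommGroup X] [Module R X]
    [AddCommGroup Y] [Module R Y] (hX : Module.Injective R X) (e : X ≃ₗ[R] Y) :
    Module.Injective R Y :=
  hX.of_retract e.symm.toLinearMap e.toLinearMap (by ext; simp)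

theorem Module.Injective.prod {X Y : Type} [AddCommGroup X] [Module R X]
    [AddCommGroup Y] [Module R Y] (hX : Module.Injective R X) (hY : Module.Injective R Y) :
    Module.Injective R (X × Y) where
  out A B _ _ _ _ f hf g := by
    obtain ⟨h, hh⟩ := hX.out f hf (LinearMap.fst R X Y ∘ₗ g)
    obtain ⟨k, hk⟩ := hY.out f hf (LinearMap.snd R X Y ∘ₗ g)
    exact ⟨h.prod k, fun a => Prod.ext (hh a) (hk a)⟩

theorem Module.Injective.of_subsingleton (X : Type) [AddCommGroup X] [Module R X]
    [Subsingleton X] : Module.Injective R X :=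
  ⟨fun _ _ _ _ _ _ _ _ _ => ⟨0, fun _ => Subsingleton.elim _ _⟩⟩

variable (R) in
/-- A sequence `X 0 → X 1 → ⋯` of injective modules which is exact except possibly at `X 0`. -/
structure InjSeq where
  /-- The terms. -/
  X : ℕ → Type
  [grp : ∀ n, AddCommGroup (X n)]
  [mod : ∀ n, Module R (X n)]
  /-- The differentials. -/
  d (n : ℕ) : X n →ₗ[R] X (n + 1)
  inj (n : ℕ) : Module.Injective R (X n)
  exact (n : ℕ) : Function.Exact (d n) (d (n + 1))

attribute [instance] InjSeq.grp InjSeq.mod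

namespace InjSeq

variable (T : InjSeq R)

/-- The cocycles. -/
abbrev Z (n : ℕ) : Submodule R (T.X n) := LinearMap.ker (T.d n)

/-- The differential, with values in the cocycles. -/
def toZ (n : ℕ) : T.X n →ₗ[R] T.Z (n + 1) :=
  (T.d n).codRestrict _ fun x => (T.exact n).apply_apply_eq_zero x

theorem toZ_surjective (n : ℕ) : Function.Surjective (T.toZ n) := by
  rintro ⟨x, hx⟩
  obtain ⟨y, rfl⟩ := (T.exact n x).1 hx
  exact ⟨y, rfl⟩

theorem exact_subtype_toZ (n : ℕ) : Function.Exact (T.Z n).subtype (T.toZ n) := by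
  intro x
  constructor
  · intro hx
    exact ⟨⟨x, congrArg Subtype.val hx⟩, rfl⟩
  · rintro ⟨x, rfl⟩
    exact Subtype.ext x.2

theorem EV_Z_iff {N : Type} [AddCommGroup N] [Module R N] (n i : ℕ) :
    EV R N (T.Z n) (i + 1) ↔ EV R N (T.Z 0) (n + i + 1) := by
  induction n generalizing i with
  | zero => rw [zero_add]
  | succ n ih =>
    rw [show n + 1 + i + 1 = n + (i + 1) + 1 by omega, ← ih (i + 1)]
    constructor
    · exact EV.fst_right Subtype.val_injective (T.toZ_surjective n) (T.exact_subtype_toZ n)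
        (EV.of_injective (T.inj n) (Nat.succ_pos _))
    · intro h
      exact EV.trd_right Subtype.val_injective (T.toZ_surjective n) (T.exact_subtype_toZ n) h
        (EV.of_injective (T.inj n) (Nat.succ_pos _))

/-- The cocycles of an injective resolution compute `Ext`. -/
theorem EV_Z_iff_of_exact {I : InjSeq R} {ι : R →ₗ[R] I.X 0}
    (hι : Function.Exact ι (I.d 0)) (hinj : Function.Injective ι) {N : Type} [AddCommGroup N]
    [Module R N] (n i : ℕ) : EV R N (I.Z n) (i + 1) ↔ EV R N R (n + i + 1) := by
  have e : R ≃ₗ[R] I.Z 0 := (LinearEquiv.ofInjective ι hinj).trans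
    (LinearEquiv.ofEq _ _ (LinearMap.exact_iff.1 hι).symm)
  rw [I.EV_Z_iff]
  exact ⟨EV.congr_right e.symm, EV.congr_right e⟩

variable (R) in
/-- Injective resolutions of `R` exist. -/
theorem exists_injectiveResolution : ∃ (I : InjSeq R) (ι : R →ₗ[R] I.X 0),
    Function.Injective ι ∧ Function.Exact ι (I.d 0) := by
  obtain ⟨J⟩ := (HasInjectiveResolutions.out (C := ModuleCat.{0} R) (ModuleCat.of R R)).out
  refine ⟨{ X := fun n => J.cocomplex.X n
            d := fun n => (J.cocomplex.d n (n + 1)).hom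
            inj := fun n => ?_
            exact := fun n => ?_ }, (J.ι.f 0).hom, ?_, ?_⟩
  · have : Injective (ModuleCat.of R (J.cocomplex.X n)) := J.injective n
    exact Module.injective_module_of_injective_object R _
  · exact (ShortComplex.ShortExact.moduleCat_exact_iff_function_exact _).1 (J.exact_succ n)
  · exact (ModuleCat.mono_iff_injective _).1 (inferInstance : Mono (J.ι.f 0))
  · exact (ShortComplex.ShortExact.moduleCat_exact_iff_function_exact _).1 J.exact₀

end InjSeq

end InjectiveSequences

section Coordinates

variable {R : Type} [CommRing R] {X : Type} [AddCommGroup X] [Module R X]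

/-- The coordinate functionals on the relation module. -/
def LinearMap.kerCoord {J : Type} (p : (J → R) →ₗ[R] X) (j : J) : Module.Dual R (LinearMap.ker p) :=
  LinearMap.proj j ∘ₗ (LinearMap.ker p).subtype

theorem LinearMap.sum_smul_kerCoord {J : Type} [Fintype J] [DecidableEq J]
    (p : (J → R) →ₗ[R] X) (ψ : Module.Dual R X) :
    ∑ j, ψ (p (Pi.single j 1)) • p.kerCoord j = 0 := by
  ext f
  have h : p f = 0 := f.2
  rw [pi_eq_sum_univ' (f : J → R)] at h
  have h' := congrArg ψ h
  simp only [map_sum, map_smul, map_zero, smul_eq_mul] at h'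
  simp only [LinearMap.sum_apply, LinearMap.smul_apply, LinearMap.kerCoord, LinearMap.comp_apply,
    LinearMap.proj_apply, Submodule.subtype_apply, smul_eq_mul, LinearMap.zero_apply]
  rw [← h']
  exact Finset.sum_congr rfl fun j _ => mul_comm _ _

end Coordinates

section Foxby

variable {R : Type} [CommRing R] [IsLocalRing R]

open IsLocalRing

/-- A sequence of injective modules which plays the role of `X ⊗ I`: the cocycles in
degree zero surject onto `X` with injective kernel, and every functional `ψ` on `X` lifts to a
chain map `Φ ψ` to the injective sequence `I`, which vanishes on socles when `ψ` takes values in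
the maximal ideal. -/
structure FoxbyApprox (I : InjSeq R) (ι : R →ₗ[R] I.X 0) (X : Type) [AddCommGroup X]
    [Module R X] where
  /-- The underlying sequence of injective modules. -/
  T : InjSeq R
  /-- The augmentation. -/
  π : T.Z 0 →ₗ[R] X
  /-- The chain maps lifting functionals. -/
  Φ : Module.Dual R X →ₗ[R] ((n : ℕ) → T.X n →ₗ[R] I.X n)
  π_surjective : Function.Surjective π
  injective_ker : Module.Injective R (LinearMap.ker π)
  Φ_d (ψ : Module.Dual R X) (n : ℕ) (x : T.X n) : Φ ψ (n + 1) (T.d n x) = I.d n (Φ ψ n x)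
  Φ_π (ψ : Module.Dual R X) (z : T.Z 0) : Φ ψ 0 z = ι (ψ (π z))
  Φ_socle (ψ : Module.Dual R X) (hψ : ∀ x, ψ x ∈ maximalIdeal R) (n : ℕ) (x : T.X n)
    (hx : ∀ a ∈ maximalIdeal R, a • x = 0) : Φ ψ n x = 0

namespace FoxbyApprox

variable {I : InjSeq R} {ι : R →ₗ[R] I.X 0} {X : Type} [AddCommGroup X] [Module R X]

variable (I ι X) in
/-- The approximation of the zero module. -/
def zero [Subsingleton X] : FoxbyApprox I ι X where
  T :=
    { X := fun _ => PUnit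
      d := fun _ => 0
      inj := fun _ => Module.Injective.of_subsingleton _
      exact := fun _ x => ⟨fun _ => ⟨0, rfl⟩, fun _ => rfl⟩ }
  π := 0
  Φ := 0
  π_surjective x := ⟨0, Subsingleton.elim _ _⟩
  injective_ker := Module.Injective.of_subsingleton _
  Φ_d _ _ _ := by simp
  Φ_π _ z := by simp
  Φ_socle _ _ _ _ _ := rfl

variable {J : Type} {p : (J → R) →ₗ[R] X}

variable (F : FoxbyApprox I ι (LinearMap.ker p))

/-- The mapping cone of the chain maps attached to the coordinate functionals. -/
def coneSeq : InjSeq R where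
  X n := F.T.X (n + 1) × (J → I.X n)
  d n := (-(F.T.d (n + 1) ∘ₗ LinearMap.fst R _ _)).prod (LinearMap.pi fun j =>
    F.Φ (p.kerCoord j) (n + 1) ∘ₗ LinearMap.fst R _ _ +
      I.d n ∘ₗ LinearMap.proj j ∘ₗ LinearMap.snd R _ _)
  inj n := by
    have := I.inj n
    exact (F.T.inj (n + 1)).prod inferInstance
  exact n := by
    rintro ⟨x, y⟩
    constructor
    · intro h
      have h1 : -(F.T.d (n + 2) x) = 0 := congrArg Prod.fst h
      have h2 (j : J) : F.Φ (p.kerCoord j) (n + 2) x + I.d (n + 1) (y j) = 0 :=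
        congrFun (congrArg Prod.snd h) j
      obtain ⟨x, rfl⟩ := (F.T.exact (n + 1) x).1 (neg_eq_zero.1 h1)
      have h3 (j : J) : ∃ v, I.d n v = y j + F.Φ (p.kerCoord j) (n + 1) x := by
        refine (I.exact n _).1 ?_
        rw [map_add, ← F.Φ_d]
        exact (add_comm _ _).trans (h2 j)
      choose v hv using h3
      refine ⟨(-x, v), Prod.ext ?_ (funext fun j => ?_)⟩
      · change -(F.T.d (n + 1) (-x)) = _
        simp
      · change F.Φ (p.kerCoord j) (n + 1) (-x) + I.d n (v j) = y j
        rw [hv, map_neg]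
        abel
    · rintro ⟨⟨x, v⟩, h⟩
      rw [← h]
      refine Prod.ext ?_ (funext fun j => ?_)
      · change -(F.T.d (n + 2) (-(F.T.d (n + 1) x))) = 0
        rw [map_neg, (F.T.exact (n + 1)).apply_apply_eq_zero, neg_zero, neg_zero]
      · change F.Φ (p.kerCoord j) (n + 2) (-(F.T.d (n + 1) x)) +
          I.d (n + 1) (F.Φ (p.kerCoord j) (n + 1) x + I.d n (v j)) = 0
        rw [map_neg, F.Φ_d, map_add, (I.exact n).apply_apply_eq_zero, add_zero, neg_add_cancel]

theorem coneSeq_d (n : ℕ) (x : F.T.X (n + 1)) (y : J → I.X n) :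
    F.coneSeq.d n (x, y) =
      (-F.T.d (n + 1) x, fun j => F.Φ (p.kerCoord j) (n + 1) x + I.d n (y j)) :=
  rfl

/-- A parametrisation of the degree zero cocycles of the cone. -/
def coneParam (hι : Function.Exact ι (I.d 0)) : F.T.X 0 × (J → R) →ₗ[R] F.coneSeq.Z 0 :=
  LinearMap.codRestrict _ ((F.T.d 0 ∘ₗ LinearMap.fst R _ _).prod (LinearMap.pi fun j =>
    ι ∘ₗ LinearMap.proj j ∘ₗ LinearMap.snd R _ _ -
      F.Φ (p.kerCoord j) 0 ∘ₗ LinearMap.fst R _ _)) (by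
    rintro ⟨w, f⟩
    refine Prod.ext ?_ (funext fun j => ?_)
    · change -F.T.d 1 (F.T.d 0 w) = 0
      rw [(F.T.exact 0).apply_apply_eq_zero, neg_zero]
    · change F.Φ (p.kerCoord j) 1 (F.T.d 0 w) + I.d 0 (ι (f j) - F.Φ (p.kerCoord j) 0 w) = 0
      rw [map_sub, hι.apply_apply_eq_zero, F.Φ_d, zero_sub, add_neg_cancel])

variable (hι : Function.Exact ι (I.d 0)) (hinj : Function.Injective ι)

theorem coneParam_apply (w : F.T.X 0) (f : J → R) : (F.coneParam hι (w, f) : F.coneSeq.X 0) =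
    (F.T.d 0 w, fun j => ι (f j) - F.Φ (p.kerCoord j) 0 w) :=
  rfl

theorem coneParam_surjective : Function.Surjective (F.coneParam hι) := by
  rintro ⟨⟨x, y⟩, h⟩
  have h1 : -F.T.d 1 x = 0 := congrArg Prod.fst h
  have h2 (j : J) : F.Φ (p.kerCoord j) 1 x + I.d 0 (y j) = 0 := congrFun (congrArg Prod.snd h) j
  obtain ⟨w, rfl⟩ := (F.T.exact 0 x).1 (neg_eq_zero.1 h1)
  have h3 (j : J) : ∃ a, ι a = F.Φ (p.kerCoord j) 0 w + y j := by
    refine (hι _).1 ?_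
    rw [map_add, ← F.Φ_d]
    exact h2 j
  choose f hf using h3
  refine ⟨(w, f), Subtype.ext ?_⟩
  rw [coneParam_apply]
  refine Prod.ext rfl (funext fun j => ?_)
  change ι (f j) - F.Φ (p.kerCoord j) 0 w = y j
  rw [hf, add_sub_cancel_left]

include hinj in
theorem coneParam_eq_zero_iff (w : F.T.X 0) (f : J → R) :
    F.coneParam hι (w, f) = 0 ↔ ∃ z : F.T.Z 0, (z : F.T.X 0) = w ∧ (F.π z : J → R) = f := by
  rw [← Subtype.val_inj, coneParam_apply]
  constructor
  · intro h
    have h1 : F.T.d 0 w = 0 := congrArg Prod.fst h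
    refine ⟨⟨w, h1⟩, rfl, funext fun j => hinj ?_⟩
    have h2 : ι (f j) - F.Φ (p.kerCoord j) 0 w = 0 := congrFun (congrArg Prod.snd h) j
    rw [sub_eq_zero] at h2
    rw [h2]
    exact (F.Φ_π (p.kerCoord j) ⟨w, h1⟩).symm
  · rintro ⟨z, rfl, rfl⟩
    refine Prod.ext z.2 (funext fun j => ?_)
    change ι ((F.π z : J → R) j) - F.Φ (p.kerCoord j) 0 z = 0
    rw [F.Φ_π, sub_eq_zero]
    rfl

include hinj in
theorem exists_coneπ : ∃ π : F.coneSeq.Z 0 →ₗ[R] X,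
    ∀ w f, π (F.coneParam hι (w, f)) = p f := by
  obtain ⟨π, hπ⟩ := LinearMap.exists_comp_eq_of_surjective (F.coneParam_surjective hι)
    (p ∘ₗ LinearMap.snd R _ _) (by
      rintro ⟨w, f⟩ h
      obtain ⟨z, rfl, rfl⟩ := (F.coneParam_eq_zero_iff hι hinj w f).1 h
      exact (F.π z).2)
  exact ⟨π, fun w f => LinearMap.congr_fun hπ (w, f)⟩

theorem injective_ker_of_coneParam (π : F.coneSeq.Z 0 →ₗ[R] X)
    (hπ : ∀ w f, π (F.coneParam hι (w, f)) = p f) (hinj : Function.Injective ι) :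
    Module.Injective R (LinearMap.ker π) := by
  let s : F.T.X 0 →ₗ[R] LinearMap.ker π :=
    (F.coneParam hι ∘ₗ LinearMap.inl R _ _).codRestrict _ fun w => by
      change π (F.coneParam hι (w, 0)) = 0
      rw [hπ, map_zero]
  have hs : Function.Surjective s := by
    rintro ⟨x, hx⟩
    obtain ⟨⟨w, f⟩, rfl⟩ := F.coneParam_surjective hι x
    rw [LinearMap.mem_ker, hπ] at hx
    obtain ⟨z, hz⟩ := F.π_surjective ⟨f, hx⟩
    have h0 : F.coneParam hι ((z : F.T.X 0), f) = 0 :=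
      (F.coneParam_eq_zero_iff hι hinj _ _).2 ⟨z, rfl, by rw [hz]⟩
    refine ⟨w - z, Subtype.ext ?_⟩
    change F.coneParam hι (w - z, 0) = F.coneParam hι (w, f)
    rw [← sub_eq_zero, ← map_sub, ← neg_eq_zero, ← map_neg, ← h0]
    congr 1
    simp
  let e : LinearMap.ker F.π →ₗ[R] LinearMap.ker s :=
    ((F.T.Z 0).subtype ∘ₗ (LinearMap.ker F.π).subtype).codRestrict _ fun z => Subtype.ext <|
      (F.coneParam_eq_zero_iff hι hinj _ _).2 ⟨z.1, rfl, by rw [z.2]; rfl⟩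
  have he : Function.Bijective e := by
    constructor
    · intro a b hab
      exact Subtype.ext (Subtype.ext (congrArg (fun t : LinearMap.ker s => (t : F.T.X 0)) hab))
    · rintro ⟨w, hw⟩
      obtain ⟨z, rfl, hz⟩ := (F.coneParam_eq_zero_iff hι hinj w 0).1 (congrArg Subtype.val hw)
      exact ⟨⟨z, Subtype.ext hz⟩, rfl⟩
  exact (F.T.inj 0).of_surjective s hs (F.injective_ker.of_equiv (LinearEquiv.ofBijective e he))

/-- The chain map on the cone lifting a functional. -/
def coneΦ [Fintype J] [DecidableEq J] :
    Module.Dual R X →ₗ[R] ((n : ℕ) → F.coneSeq.X n →ₗ[R] I.X n) where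
  toFun ψ n :=
    { toFun := fun x : F.T.X (n + 1) × (J → I.X n) => ∑ j, ψ (p (Pi.single j 1)) • x.2 j
      map_add' := fun (x y : F.T.X (n + 1) × (J → I.X n)) =>
        (Finset.sum_congr rfl fun j _ => smul_add _ _ _).trans Finset.sum_add_distrib
      map_smul' := fun a (x : F.T.X (n + 1) × (J → I.X n)) =>
        (Finset.sum_congr rfl fun j _ => smul_comm _ _ _).trans Finset.smul_sum.symm }
  map_add' ψ φ := by
    funext n
    refine LinearMap.ext fun x => ?_
    exact (Finset.sum_congr rfl fun j _ => add_smul _ _ _).trans Finset.sum_add_distrib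
  map_smul' a ψ := by
    funext n
    refine LinearMap.ext fun x => ?_
    exact (Finset.sum_congr rfl fun j _ => mul_smul _ _ _).trans Finset.smul_sum.symm

theorem coneΦ_apply [Fintype J] [DecidableEq J] (ψ : Module.Dual R X) (n : ℕ)
    (x : F.T.X (n + 1)) (y : J → I.X n) :
    F.coneΦ ψ n (x, y) = ∑ j, ψ (p (Pi.single j 1)) • y j :=
  rfl

theorem sum_smul_Φ [Fintype J] [DecidableEq J] (ψ : Module.Dual R X) (n : ℕ) (x : F.T.X n) :
    ∑ j, ψ (p (Pi.single j 1)) • F.Φ (p.kerCoord j) n x = 0 := by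
  have h := LinearMap.congr_fun (congrFun (congrArg F.Φ (p.sum_smul_kerCoord ψ)) n) x
  simpa only [map_sum, map_smul, map_zero, Finset.sum_apply, Pi.smul_apply, LinearMap.sum_apply,
    LinearMap.smul_apply, Pi.zero_apply, LinearMap.zero_apply] using h

/-- The mapping cone approximates the cokernel of the relation module. -/
noncomputable def cone [Fintype J] [DecidableEq J] (hp : Function.Surjective p) :
    FoxbyApprox I ι X where
  T := F.coneSeq
  π := (F.exists_coneπ hι hinj).choose
  Φ := F.coneΦ
  π_surjective x := by
    obtain ⟨f, rfl⟩ := hp x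
    exact ⟨_, (F.exists_coneπ hι hinj).choose_spec 0 f⟩
  injective_ker :=
    F.injective_ker_of_coneParam hι _ (F.exists_coneπ hι hinj).choose_spec hinj
  Φ_d ψ n x := by
    obtain ⟨x, y⟩ := x
    rw [coneSeq_d, coneΦ_apply, coneΦ_apply, map_sum]
    simp only [smul_add, Finset.sum_add_distrib, map_smul]
    rw [F.sum_smul_Φ, zero_add]
  Φ_π ψ z := by
    obtain ⟨⟨w, f⟩, rfl⟩ := F.coneParam_surjective hι z
    rw [(F.exists_coneπ hι hinj).choose_spec, coneParam_apply, coneΦ_apply]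
    simp only [smul_sub, Finset.sum_sub_distrib]
    rw [F.sum_smul_Φ, sub_zero]
    conv_rhs => rw [pi_eq_sum_univ' f]
    simp only [map_sum, map_smul, smul_eq_mul]
    refine Finset.sum_congr rfl fun j _ => ?_
    rw [← smul_eq_mul, ← map_smul, ← map_smul, smul_eq_mul, mul_comm]
    simp
  Φ_socle ψ hψ n x hx := by
    obtain ⟨x, y⟩ := x
    rw [coneΦ_apply]
    exact Finset.sum_eq_zero fun j _ => congrFun (congrArg Prod.snd (hx _ (hψ _))) j

/-- The inclusion of the cocycles of `I` in those of the cone, at a given coordinate. -/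
def coneInclusion [DecidableEq J] (j : J) (n : ℕ) : I.Z n →ₗ[R] F.coneSeq.Z n :=
  (LinearMap.inr R (F.T.X (n + 1)) (J → I.X n) ∘ₗ LinearMap.single R _ j ∘ₗ
    (I.Z n).subtype).codRestrict _ fun z => by
      change F.coneSeq.d n (0, Pi.single j (z : I.X n)) = 0
      rw [coneSeq_d]
      refine Prod.ext (neg_eq_zero.2 (map_zero _)) (funext fun i => ?_)
      change F.Φ (p.kerCoord i) (n + 1) 0 + I.d n ((Pi.single j (z : I.X n) : J → I.X n) i) = 0
      rw [map_zero, zero_add]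
      by_cases hij : i = j
      · subst hij
        rw [Pi.single_eq_same]
        exact z.2
      · rw [Pi.single_eq_of_ne hij, map_zero]

theorem EV_residueField_Z [DecidableEq J] {j : J}
    (hj : ∀ f, p f = 0 → f j ∈ maximalIdeal R) {n : ℕ}
    (h : EV R (R ⧸ maximalIdeal R) (F.coneSeq.Z n) 1) :
    EV R (R ⧸ maximalIdeal R) (I.Z n) 1 := by
  refine EV.one_of_lifts Subtype.val_injective (I.toZ_surjective n) (I.exact_subtype_toZ n)
    (EV.of_injective (I.inj n) one_pos) fun φ => ?_
  obtain ⟨l, hl⟩ := h.exists_lift Subtype.val_injective (F.coneSeq.toZ_surjective n)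
    (F.coneSeq.exact_subtype_toZ n) (F.coneInclusion j (n + 1) ∘ₗ φ)
  let l' : (R ⧸ maximalIdeal R) →ₗ[R] F.T.X (n + 1) × (J → I.X n) := l
  refine ⟨LinearMap.proj j ∘ₗ LinearMap.snd R _ _ ∘ₗ l', LinearMap.ext fun t => ?_⟩
  have h1 : F.coneSeq.d n ((l' t).1, (l' t).2) =
      (0, Pi.single j (φ t : I.X (n + 1))) := congrArg Subtype.val (LinearMap.congr_fun hl t)
  rw [coneSeq_d] at h1
  have h2 : F.Φ (p.kerCoord j) (n + 1) (l' t).1 + I.d n ((l' t).2 j) =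
      (Pi.single j (φ t : I.X (n + 1)) : J → I.X (n + 1)) j :=
    congrFun (congrArg Prod.snd h1) j
  rw [F.Φ_socle _ (fun f => hj f.1 f.2), zero_add, Pi.single_eq_same] at h2
  · exact Subtype.ext h2
  · intro a ha
    have h3 : a • t = 0 := by
      obtain ⟨t, rfl⟩ := Ideal.Quotient.mk_surjective t
      change Ideal.Quotient.mk _ (a * t) = 0
      exact Ideal.Quotient.eq_zero_iff_mem.2 (Ideal.mul_mem_right _ _ ha)
    have h4 := l'.map_smul a t
    rw [h3, map_zero] at h4
    exact (congrArg Prod.fst h4).symm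

end FoxbyApprox

end Foxby

section Foxby

variable {R : Type} [CommRing R] [IsNoetherianRing R] [IsLocalRing R]

open IsLocalRing

theorem nonempty_foxbyApprox {I : InjSeq R} {ι : R →ₗ[R] I.X 0} (hι : Function.Exact ι (I.d 0))
    (hinj : Function.Injective ι) (n : ℕ) (X : Type) [AddCommGroup X] [Module R X]
    [Module.Finite R X] (h : HasProjectiveDimensionLT (ModuleCat.of R X) n) :
    Nonempty (FoxbyApprox I ι X) := by
  induction n generalizing X with
  | zero =>
    have : Subsingleton X :=
      ModuleCat.subsingleton_of_isZero (M := ModuleCat.of R X)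
        (isZero_of_hasProjectiveDimensionLT_zero _)
    exact ⟨FoxbyApprox.zero I ι X⟩
  | succ n ih =>
    cases n with
    | zero =>
      have hproj : Projective (ModuleCat.of R X) :=
        projective_iff_hasProjectiveDimensionLT_one.2 h
      have : Module.Projective R X := (IsProjective.iff_projective X).2 hproj
      have : Module.Free R X := Module.free_of_flat_of_isLocalRing
      let e := (Module.finBasis R X).equivFun.symm
      have : Subsingleton (LinearMap.ker e.toLinearMap) := by
        rw [LinearEquiv.ker]
        infer_instance
      exact ⟨(FoxbyApprox.zero I ι (LinearMap.ker e.toLinearMap)).cone hι hinj e.surjective⟩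
    | succ n =>
      obtain ⟨m, p, hp⟩ := Module.Finite.exists_fin' R X
      obtain ⟨w, hS⟩ := exists_shortExact (LinearMap.ker p).subtype_injective hp
        p.exact_subtype_ker_map
      have h2 : Projective (ModuleCat.of R (Fin m → R)) :=
        (IsProjective.iff_projective _).1 inferInstance
      obtain ⟨F⟩ := ih (LinearMap.ker p) ((hS.hasProjectiveDimensionLT_X₃_iff n h2).1 h)
      exact ⟨F.cone hι hinj hp⟩

/-- A nonzero finitely generated module over a local ring has a finite generating family with a
member whose coefficient in every relation is a nonunit. -/
theorem exists_presentation (M : Type) [AddCommGroup M] [Module R M] [Module.Finite R M]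
    [Nontrivial M] : ∃ (r : ℕ) (p : (Option (Fin r) → R) →ₗ[R] M), Function.Surjective p ∧
      ∀ f, p f = 0 → f none ∈ maximalIdeal R := by
  obtain ⟨N, hN, -⟩ := (eq_top_or_exists_le_coatom (⊥ : Submodule R M)).resolve_left bot_ne_top
  have : IsSimpleModule R (M ⧸ N) := isSimpleModule_iff_isCoatom.2 hN
  obtain ⟨𝔪, h𝔪, ⟨e⟩⟩ := isSimpleModule_iff_quot_maximal.1 this
  obtain rfl := eq_maximalIdeal h𝔪
  obtain ⟨x₀, hx₀⟩ := (e.surjective.comp N.mkQ_surjective) 1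
  obtain ⟨r, p₁, hp₁⟩ := Module.Finite.exists_fin' R N
  let p : (Option (Fin r) → R) →ₗ[R] M :=
    (LinearMap.proj none).smulRight x₀ + N.subtype ∘ₗ p₁ ∘ₗ LinearMap.funLeft R R some
  have hp (f) : p f = f none • x₀ + (p₁ (f ∘ some) : M) := rfl
  have hψ (a : R) (y : N) :
      e (N.mkQ (a • x₀ + (y : M))) = Ideal.Quotient.mk (maximalIdeal R) a := by
    have hy : N.mkQ (y : M) = 0 := (Submodule.Quotient.mk_eq_zero _).2 y.2
    have hx : e (N.mkQ x₀) = 1 := hx₀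
    rw [map_add, hy, add_zero, map_smul, map_smul, hx, Algebra.smul_def, mul_one]
    rfl
  refine ⟨r, p, fun m => ?_, fun f hf => ?_⟩
  · obtain ⟨a, ha⟩ := Ideal.Quotient.mk_surjective (e (N.mkQ m))
    have h1 : m - a • x₀ ∈ N := by
      rw [← N.ker_mkQ, LinearMap.mem_ker, map_sub, sub_eq_zero]
      apply e.injective
      have := hψ a 0
      rw [ZeroMemClass.coe_zero, add_zero] at this
      rw [this, ha]
    obtain ⟨f, hf⟩ := hp₁ ⟨_, h1⟩
    refine ⟨fun o => o.elim a f, ?_⟩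
    rw [hp]
    change a • x₀ + (p₁ f : M) = m
    rw [hf]
    exact add_sub_cancel _ _
  · have := hψ (f none) (p₁ (f ∘ some))
    rw [← hp, hf, map_zero, map_zero] at this
    exact Ideal.Quotient.eq_zero_iff_mem.1 this.symm

/-- If a nonzero finitely generated module `M` of finite projective dimension satisfies
`Ext^i(k, M) = 0` for large `i`, then `Ext^i(k, R) = 0` for large `i`. -/
theorem EV.residueField_self {M : Type} [AddCommGroup M] [Module R M] [Module.Finite R M]
    [Nontrivial M] {n b : ℕ} (hpd : HasProjectiveDimensionLT (ModuleCat.of R M) n)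
    (hM : ∀ i, b < i → EV R (R ⧸ maximalIdeal R) M i) {i : ℕ} (hi : b < i) :
    EV R (R ⧸ maximalIdeal R) R i := by
  obtain ⟨I, ι, hinj, hι⟩ := InjSeq.exists_injectiveResolution R
  obtain ⟨r, p, hp, hnone⟩ := exists_presentation (R := R) M
  obtain ⟨w, hS⟩ := exists_shortExact (LinearMap.ker p).subtype_injective hp
    p.exact_subtype_ker_map
  have h2 : Projective (ModuleCat.of R (Option (Fin r) → R)) :=
    (IsProjective.iff_projective _).1 inferInstance
  have hpd' : HasProjectiveDimensionLT (ModuleCat.of R M) (n + 2) :=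
    hasProjectiveDimensionLT_of_ge _ n _ (by omega)
  obtain ⟨F⟩ := nonempty_foxbyApprox hι hinj (n + 1) (LinearMap.ker p)
    ((hS.hasProjectiveDimensionLT_X₃_iff n h2).1 hpd')
  let C := F.cone hι hinj hp
  have hZ0 (i : ℕ) (hi : b < i) : EV R (R ⧸ maximalIdeal R) (F.coneSeq.Z 0) i :=
    EV.mid_right (f := (LinearMap.ker C.π).subtype) Subtype.val_injective C.π_surjective
      C.π.exact_subtype_ker_map (EV.of_injective C.injective_ker (by omega)) (hM i hi)
  obtain ⟨i, rfl⟩ := Nat.exists_eq_succ_of_ne_zero (Nat.ne_zero_of_lt hi)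
  rw [Nat.succ_eq_add_one, ← add_zero i, ← InjSeq.EV_Z_iff_of_exact hι hinj]
  refine F.EV_residueField_Z hnone ?_
  rw [InjSeq.EV_Z_iff]
  exact hZ0 _ hi

/-- If `Ext^i(k, R) = 0` for all `i > b` then `R` has injective dimension at most `b`. -/
theorem EV.self_of_residueField {b : ℕ} (h : ∀ i, b < i → EV R (R ⧸ maximalIdeal R) R i)
    {N : Type} [AddCommGroup N] [Module R N] {i : ℕ} (hi : b < i) : EV R N R i := by
  obtain ⟨I, ι, hinj, hι⟩ := InjSeq.exists_injectiveResolution R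
  have hZ : Module.Injective R (I.Z b) := by
    apply Module.Baer.injective
    intro J g
    have h1 : EV R (R ⧸ J) (I.Z b) 1 :=
      (InjSeq.EV_Z_iff_of_exact hι hinj b 0).2 (EV.of_residueField h (by omega))
    obtain ⟨ψ, hψ⟩ := h1.exists_extension (f := J.subtype) Subtype.val_injective
      J.mkQ_surjective (LinearMap.exact_subtype_mkQ J) g
    exact ⟨ψ, fun x hx => LinearMap.congr_fun hψ ⟨x, hx⟩⟩
  obtain ⟨j, rfl⟩ := Nat.exists_eq_add_of_lt hi
  exact (InjSeq.EV_Z_iff_of_exact hι hinj b j).1 (EV.of_injective hZ (Nat.succ_pos _))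

end Foxby

theorem gorenstein_of_finite_injDim_and_finite_Gdim
    (R : Type) [CommRing R] [IsNoetherianRing R] [IsLocalRing R]
    (M : ModuleCat R) (hM : Nontrivial M) (hfg : Module.Finite R M)
    (hinj : ∃ n : ℕ, injDimLE R M n)
    (hGdim : ∃ n : ℕ, GdimLE R n M) :
    IsGorensteinRing R := by
  obtain ⟨b, hb⟩ := hinj
  obtain ⟨n, hn⟩ := hGdim
  have hb' (N : Type) [AddCommGroup N] [Module R N] (i : ℕ) (hi : b < i) : EV R N M i :=
    (extVanish_iff_EV (ModuleCat.of R N) M (Nat.zero_lt_of_lt hi)).1 (hb _ i hi)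
  refine ⟨b, fun N i hi => (extVanish_iff_EV _ _ (Nat.zero_lt_of_lt hi)).2 ?_⟩
  exact EV.self_of_residueField (fun i hi => EV.residueField_self
    (hn.hasPdHull.hasProjectiveDimensionLT hb') (fun i hi => hb' _ i hi) hi) hi
end

section
/- Let R be a commutative Noetherian local ring and M a nonzero finitely generated R-module. If the Auslander bound B(M) is finite, Ext^i_R(M,R) = 0 for i ≫ 0, and Ext^i_R(M,M) = 0 for i ≫ 0, then M has finite projective dimension. -/
/-!
STATEMENT 8: Let `R` be a commutative Noetherian local ring and `M` a nonzero finitely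
generated `R`-module.  If the Auslander bound `B(M)` is finite, `Ext^i_R(M,R) = 0` for
`i ≫ 0`, and `Ext^i_R(M,M) = 0` for `i ≫ 0`, then `M` has finite projective dimension.
-/

open CategoryTheory

/-- `P R M N = sup { n : Ext^n_R(M,N) ≠ 0 }`, as an extended natural number
(`0` if the set is empty, `⊤` if it is unbounded). -/
noncomputable def extSup (R : Type) [CommRing R] (M N : ModuleCat R) : ℕ∞ :=
  sSup {c : ℕ∞ | ∃ n : ℕ, c = n ∧ ¬ extVanish R M N n}

/-- The Auslander bound of `M`:
`B(M) = sup { P(M,N) : N finitely generated nonzero with P(M,N) < ∞ }`. -/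
noncomputable def auslanderBound (R : Type) [CommRing R] (M : ModuleCat R) : ℕ∞ :=
  sSup {c : ℕ∞ | ∃ N : ModuleCat R, Module.Finite R N ∧ Nontrivial N ∧
    extSup R M N ≠ ⊤ ∧ c = extSup R M N}

lemma extVanish_succ_iff (R : Type) [CommRing R] (M N : ModuleCat R) (n : ℕ) :
    extVanish R M N (n + 1) ↔ Subsingleton (Abelian.Ext M N (n + 1)) := by
  let P := projectiveResolution M
  have h : extVanish R M N (n + 1) ↔
      ∀ f : P.complex.X (n + 1) ⟶ N, P.complex.d (n + 2) (n + 1) ≫ f = 0 →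
        ∃ g : P.complex.X n ⟶ N, P.complex.d (n + 1) n ≫ g = f := by
    rw [extVanish, extRMod, ← ModuleCat.isZero_iff_subsingleton,
      (P.isoExt (R := R) (n + 1) N).isZero_iff,
      ← HomologicalComplex.exactAt_iff_isZero_homology,
      HomologicalComplex.exactAt_iff' _ n (n + 1) (n + 2) (by simp) (by simp),
      ShortComplex.moduleCat_exact_iff]
    rfl
  rw [h]
  constructor
  · intro h
    refine subsingleton_of_forall_eq 0 fun x ↦ ?_
    obtain ⟨f, hf, rfl⟩ := P.extMk_surjective x (n + 2) rfl
    exact (P.extMk_eq_zero_iff f (n + 2) rfl hf n rfl).2 (h f hf)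
  · intro h f hf
    exact (P.extMk_eq_zero_iff f (n + 2) rfl hf n rfl).1 (Subsingleton.elim _ _)

lemma extVanish_iff_of_pos (R : Type) [CommRing R] (M N : ModuleCat R) {n : ℕ} (hn : 0 < n) :
    extVanish R M N n ↔ Subsingleton (Abelian.Ext M N n) := by
  obtain ⟨k, rfl⟩ := Nat.exists_eq_succ_of_ne_zero hn.ne'
  exact extVanish_succ_iff R M N k

lemma subsingleton_ext_of_finite_free {R : Type} [CommRing R] (M P : ModuleCat R)
    [Module.Finite R P] [Module.Free R P] (n : ℕ)
    (h : Subsingleton (Abelian.Ext M (ModuleCat.of R R) n)) :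
    Subsingleton (Abelian.Ext M P n) := by
  let b := Module.Free.chooseBasis R P
  have key : 𝟙 P = ∑ i, ModuleCat.ofHom (b.coord i) ≫
      ModuleCat.ofHom (LinearMap.toSpanSingleton R P (b i)) := by
    ext x
    simp [ModuleCat.hom_sum, b.sum_repr]
  refine subsingleton_of_forall_eq 0 fun x ↦ ?_
  rw [← x.comp_mk₀_id, key, Abelian.Ext.mk₀_sum, Abelian.Ext.comp_sum]
  refine Finset.sum_eq_zero fun i _ ↦ ?_
  rw [← Abelian.Ext.mk₀_comp_mk₀, ← Abelian.Ext.comp_assoc_of_second_deg_zero,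
    Subsingleton.elim (x.comp _ _) 0, Abelian.Ext.zero_comp]

/-- Every class in `Ext^(k + j)(M, N)` is a multiple of the class in `Ext^k(M, K)` of the
exact sequence joining `M` to its `k`-th syzygy `K`. -/
lemma exists_syzygy_class {R : Type} [CommRing R] [IsNoetherianRing R] (M : ModuleCat R)
    [Module.Finite R M]
    (hMR : ∃ n : ℕ, ∀ i : ℕ, n < i → Subsingleton (Abelian.Ext M (ModuleCat.of R R) i))
    (hMM : ∃ n : ℕ, ∀ i : ℕ, n < i → Subsingleton (Abelian.Ext M M i)) (k : ℕ) :
    ∃ (K : ModuleCat R) (e : Abelian.Ext M K k), Module.Finite R K ∧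
      (∃ n : ℕ, ∀ i : ℕ, n < i → Subsingleton (Abelian.Ext M K i)) ∧
      ∀ (N : ModuleCat R) (j m : ℕ) (hm : k + j = m) (x : Abelian.Ext M N m),
        ∃ y : Abelian.Ext K N j, e.comp y hm = x := by
  induction k with
  | zero =>
    refine ⟨M, Abelian.Ext.mk₀ (𝟙 M), inferInstance, hMM, fun N j m hm x ↦ ?_⟩
    obtain rfl : j = m := by lia
    exact ⟨x, x.mk₀_id_comp⟩
  | succ k ih =>
    obtain ⟨K, e, hK, ⟨a, ha⟩, h⟩ := ih
    obtain ⟨c, hc⟩ := hMR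
    obtain ⟨P, _, _, _, _, f, hf⟩ := Module.exists_finite_presentation R K
    have hS := LinearMap.shortExact_shortComplexKer hf
    refine ⟨f.shortComplexKer.X₁, e.comp hS.extClass rfl,
      inferInstanceAs (Module.Finite R (LinearMap.ker f)),
      ⟨max a c + 1, fun i hi ↦ ?_⟩, fun N j m hm x ↦ ?_⟩
    · obtain ⟨i, rfl⟩ : ∃ l, i = l + 1 := ⟨i - 1, by lia⟩
      have := ha i (by lia)
      have : Subsingleton (Abelian.Ext M f.shortComplexKer.X₂ (i + 1)) :=
        subsingleton_ext_of_finite_free M (ModuleCat.of R P) _ (hc _ (by lia))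
      refine subsingleton_of_forall_eq 0 fun x ↦ ?_
      obtain ⟨y, rfl⟩ := Abelian.Ext.covariant_sequence_exact₁ M hS x (Subsingleton.elim _ _) rfl
      rw [Subsingleton.elim y 0, Abelian.Ext.zero_comp]
    · obtain ⟨y, rfl⟩ := h N (j + 1) m (by lia) x
      obtain ⟨z, rfl⟩ := precomp_extClass_surjective_of_projective_X₂ N hS j y
      exact ⟨z, Abelian.Ext.comp_assoc _ _ _ _ (add_comm 1 j) (by lia)⟩

/-- A nonzero finitely generated `N` with `Ext^i(M, N) = 0` for `i ≫ 0` has `Ext^i(M, N) = 0`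
for all `i` above any finite bound of the Auslander bound. -/
lemma extVanish_of_auslanderBound_le {R : Type} [CommRing R] {M N : ModuleCat R} {b : ℕ}
    (hb : auslanderBound R M ≤ b) [Module.Finite R N] [Nontrivial N]
    (h : ∃ n : ℕ, ∀ i : ℕ, n < i → extVanish R M N i) {i : ℕ} (hi : b < i) :
    extVanish R M N i := by
  obtain ⟨n, hn⟩ := h
  have hfin : extSup R M N ≤ n := by
    refine sSup_le ?_
    rintro _ ⟨m, rfl, hm⟩
    exact_mod_cast not_lt.1 fun hlt ↦ hm (hn m hlt)
  have hmem : extSup R M N ≤ auslanderBound R M := by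
    rw [auslanderBound]
    exact le_sSup ⟨N, ‹_›, ‹_›, ne_top_of_le_ne_top (ENat.natCast_ne_top n) hfin, rfl⟩
  by_contra hne
  have hi_le : (i : ℕ∞) ≤ extSup R M N := by
    rw [extSup]
    exact le_sSup ⟨i, rfl, hne⟩
  exact absurd (by exact_mod_cast hi_le.trans (hmem.trans hb)) (not_le.2 hi)

theorem finite_projDim_of_finite_auslanderBound
    (R : Type) [CommRing R] [IsNoetherianRing R] [IsLocalRing R]
    (M : ModuleCat R) (hM : Nontrivial M) (hfg : Module.Finite R M)
    (hB : auslanderBound R M ≠ ⊤)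
    (hMR : ∃ n : ℕ, ∀ i : ℕ, n < i → extVanish R M (ModuleCat.of R R) i)
    (hMM : ∃ n : ℕ, ∀ i : ℕ, n < i → extVanish R M M i) :
    ∃ n : ℕ, projDimLE R M n := by
  obtain ⟨b, hb⟩ := ENat.ne_top_iff_exists.1 hB
  have conv : ∀ N : ModuleCat R, (∃ n : ℕ, ∀ i : ℕ, n < i → extVanish R M N i) ↔
      ∃ n : ℕ, ∀ i : ℕ, n < i → Subsingleton (Abelian.Ext M N i) := fun N ↦
    exists_congr fun n ↦ forall_congr' fun i ↦ imp_congr_right fun hi ↦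
      extVanish_iff_of_pos R M N (Nat.zero_lt_of_lt hi)
  obtain ⟨K, e, hK, hMK, h⟩ :=
    exists_syzygy_class M ((conv _).1 hMR) ((conv _).1 hMM) (b + 1)
  have he : e = 0 := by
    rcases subsingleton_or_nontrivial K with hK0 | hK0
    · rw [← e.comp_mk₀_id, (ModuleCat.isZero_iff_subsingleton.2 hK0).eq_of_src (𝟙 K) 0,
        Abelian.Ext.mk₀_zero, Abelian.Ext.comp_zero]
    · have := (extVanish_succ_iff R M K b).1
        (extVanish_of_auslanderBound_le hb.ge ((conv K).2 hMK) b.lt_succ_self)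
      exact Subsingleton.elim _ _
  refine ⟨b, fun N i hi ↦ (extVanish_iff_of_pos R M N (Nat.zero_lt_of_lt hi)).2 ?_⟩
  refine subsingleton_of_forall_eq 0 fun x ↦ ?_
  obtain ⟨y, rfl⟩ := h N (i - (b + 1)) i (by lia) x
  rw [he, Abelian.Ext.zero_comp]
end
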